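/- Let R be a commutative noetherian ring with a dualizing module and Krull dimension d, and let G be a Gorenstein injective R-module. For each k ≥ 0 set G_k = Σ_p Γ_p(G), the sum inside G of the p-torsion submodules over all prime ideals p of height k. Then: (i) G_{d+1} = 0 and G_0 = G; (ii) G_{k+1} ⊆ G_k for all 0 ≤ k ≤ d; (iii) each G_k is a Gorenstein injective R-module; and (iv) for each 0 ≤ k ≤ d, the image of G_k under the quotient map G → G/G_{k+1} equals Σ_p Γ_p(G/G_{k+1}), the sum over all primes p of height k of the p-torsion submodules of G/G_{k+1}. -/

import Mathlib

open CategoryTheory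

universe u

/-- The `a`-torsion submodule `Γ_a(M) = {x ∈ M | a^n x = 0 for some n}`. -/
def torsionGamma {R : Type u} [CommRing R] (a : Ideal R) (M : Type u)
    [AddCommGroup M] [Module R M] : Submodule R M :=
  ⨆ n : ℕ, Submodule.torsionBySet R M ((a ^ n : Ideal R) : Set R)

/-- Data witnessing that `G` is Gorenstein injective: a ℤ-indexed exact complex of
injective modules, remaining exact after `Hom_R(E', -)` for every injective `E'`,
with `G ≅ ker(E_0 → E_{-1})`. -/
structure GorensteinInjData (R : Type u) [CommRing R] (G : Type u)
    [AddCommGroup G] [Module R G] where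
  E : ℤ → Type u
  [acg : ∀ i, AddCommGroup (E i)]
  [mod : ∀ i, Module R (E i)]
  d : ∀ i : ℤ, E (i + 1) →ₗ[R] E i
  inj : ∀ i, Module.Injective R (E i)
  exact : ∀ i : ℤ, LinearMap.range (d (i + 1)) = LinearMap.ker (d i)
  homExact : ∀ (E' : Type u) [AddCommGroup E'] [Module R E'], Module.Injective R E' →
      ∀ (i : ℤ) (g : E' →ₗ[R] E (i + 1)),
        (d i).comp g = 0 ↔ ∃ f : E' →ₗ[R] E (i + 1 + 1), (d (i + 1)).comp f = g
  equiv : G ≃ₗ[R] LinearMap.ker (d (-1))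

/-- An `R`-module `G` is Gorenstein injective. -/
def IsGorensteinInjective (R : Type u) [CommRing R] (G : Type u)
    [AddCommGroup G] [Module R G] : Prop :=
  Nonempty (GorensteinInjData R G)

/-- Data witnessing that `M` is Gorenstein flat. -/
structure GorensteinFlatData (R : Type u) [CommRing R] (M : Type u)
    [AddCommGroup M] [Module R M] where
  F : ℤ → Type u
  [acg : ∀ i, AddCommGroup (F i)]
  [mod : ∀ i, Module R (F i)]
  d : ∀ i : ℤ, F (i + 1) →ₗ[R] F i
  flat : ∀ i, Module.Flat R (F i)
  exact : ∀ i : ℤ, LinearMap.range (d (i + 1)) = LinearMap.ker (d i)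
  tensorExact : ∀ (E' : Type u) [AddCommGroup E'] [Module R E'], Module.Injective R E' →
      ∀ i : ℤ, LinearMap.range (LinearMap.lTensor E' (d (i + 1)))
        = LinearMap.ker (LinearMap.lTensor E' (d i))
  equiv : M ≃ₗ[R] LinearMap.ker (d (-1))

/-- An `R`-module `M` is Gorenstein flat. -/
def IsGorensteinFlat (R : Type u) [CommRing R] (M : Type u)
    [AddCommGroup M] [Module R M] : Prop :=
  Nonempty (GorensteinFlatData R M)

/-- `E` is an injective hull of `M`: `E` is injective and admits an injective
linear map from `M` with essential image. -/
def IsInjectiveHull (R : Type u) [CommRing R] (M : Type u) [AddCommGroup M] [Module R M]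
    (E : Type u) [AddCommGroup E] [Module R E] : Prop :=
  Module.Injective R E ∧ ∃ f : M →ₗ[R] E, Function.Injective f ∧
    ∀ N : Submodule R E, N ≠ ⊥ → N ⊓ LinearMap.range f ≠ ⊥

/-- `D` is a dualizing module for `R`: finitely generated, of finite injective dimension,
the homothety map `R → Hom_R(D,D)` is bijective, and `Ext^i_R(D,D) = 0` for `i ≥ 1`. -/
def IsDualizingModule (R : Type u) [CommRing R] (D : Type u)
    [AddCommGroup D] [Module R D] : Prop :=
  Module.Finite R D ∧
  (∃ n : ℕ, ∀ (M : Type u) (_ : AddCommGroup M) (_ : Module R M), ∀ i : ℕ, n < i →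
      Limits.IsZero (((Ext R (ModuleCat.{u} R) i).obj
        (Opposite.op (ModuleCat.of R M))).obj (ModuleCat.of R D))) ∧
  Function.Bijective (fun r : R => (r • (LinearMap.id : D →ₗ[R] D))) ∧
  (∀ i : ℕ, 0 < i →
    Limits.IsZero (((Ext R (ModuleCat.{u} R) i).obj
      (Opposite.op (ModuleCat.of R D))).obj (ModuleCat.of R D)))

/-- The height of a prime ideal, as the `Order.height` of the corresponding
point of the prime spectrum. -/
noncomputable def idealHeight {R : Type u} [CommRing R] (p : Ideal R) (hp : p.IsPrime) : ℕ∞ :=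
  Order.height (⟨p, hp⟩ : PrimeSpectrum R)


section Part1
variable {R : Type u} [CommRing R]

/-- every `δ`-cocycle `L → Y` is a coboundary -/
def Cls {Y : Type u} [AddCommGroup Y] [Module R Y] (δ : Y →ₗ[R] Y)
    (L : Type u) [AddCommGroup L] [Module R L] : Prop :=
  ∀ f : L →ₗ[R] Y, δ ∘ₗ f = 0 → ∃ h : L →ₗ[R] Y, δ ∘ₗ h = f

/-- the version of `Cls` for submodules -/
def ClsS {Y : Type u} [AddCommGroup Y] [Module R Y] (δ : Y →ₗ[R] Y)
    {Q : Type u} [AddCommGroup Q] [Module R Q] (N : Submodule R Q) : Prop :=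
  ∀ g : Q →ₗ[R] Y, (∀ x ∈ N, δ (g x) = 0) → ∃ h : Q →ₗ[R] Y, ∀ x ∈ N, δ (h x) = g x

variable {Y : Type u} [AddCommGroup Y] [Module R Y] {δ : Y →ₗ[R] Y}
variable {A B C : Type u} [AddCommGroup A] [Module R A] [AddCommGroup B] [Module R B]
  [AddCommGroup C] [Module R C]

lemma factor_surj {M : Type u} [AddCommGroup M] [Module R M]
    (p : B →ₗ[R] C) (hp : Function.Surjective p) (f : B →ₗ[R] M)
    (h : ∀ x, p x = 0 → f x = 0) : ∃ g : C →ₗ[R] M, g ∘ₗ p = f := by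
  let e := p.quotKerEquivOfSurjective hp
  refine ⟨(p.ker.liftQ f (fun x hx => h x hx)) ∘ₗ e.symm.toLinearMap, ?_⟩
  ext x
  have : e.symm (p x) = Submodule.Quotient.mk x := by
    rw [LinearEquiv.symm_apply_eq]; rfl
  simp only [LinearMap.comp_apply, LinearEquiv.coe_coe, this]
  exact Submodule.liftQ_apply _ _ _

lemma Cls.coker (hY : Module.Injective R Y) (hδ : δ ∘ₗ δ = 0)
    (i : A →ₗ[R] B) (p : B →ₗ[R] C) (hi : Function.Injective i)
    (hp : Function.Surjective p) (hip : Function.Exact i p) (hA : Cls δ A) (hB : Cls δ B) :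
    Cls δ C := by
  intro f hf
  obtain ⟨h, hh⟩ := hB (f ∘ₗ p) (by rw [← LinearMap.comp_assoc, hf, LinearMap.zero_comp])
  obtain ⟨k, hk⟩ := hA (h ∘ₗ i) (by
    rw [← LinearMap.comp_assoc, hh, LinearMap.comp_assoc, hip.linearMap_comp_eq_zero,
      LinearMap.comp_zero])
  obtain ⟨k', hk'⟩ := Module.Injective.extension_property R Y _ _ i hi k
  obtain ⟨h'', hh''⟩ := factor_surj p hp (h - δ ∘ₗ k') (by
    intro x hx
    obtain ⟨a, rfl⟩ := (hip x).1 hx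
    have h1 := LinearMap.congr_fun hk a
    have h2 := LinearMap.congr_fun hk' a
    simp at h1 h2 ⊢
    rw [h2, h1, sub_self])
  refine ⟨h'', ?_⟩
  apply LinearMap.ext
  intro c
  obtain ⟨b, rfl⟩ := hp c
  have h1 := LinearMap.congr_fun hh'' b
  have h2 := LinearMap.congr_fun hh b
  have h3 := LinearMap.congr_fun hδ (k' b)
  simp at h1 h2 h3 ⊢
  rw [h1, map_sub, h2, h3, sub_zero]

lemma Cls.ker (hY : Module.Injective R Y) 
    (i : A →ₗ[R] B) (p : B →ₗ[R] C) (hi : Function.Injective i)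
    (hp : Function.Surjective p) (hip : Function.Exact i p) (hδ : δ ∘ₗ δ = 0)
    (hB : Cls δ B) (hC : Cls δ C) :
    Cls δ A := by
  intro f hf
  obtain ⟨f', hf'⟩ := Module.Injective.extension_property R Y _ _ i hi f
  obtain ⟨g, hg⟩ := factor_surj p hp (δ ∘ₗ f') (by
    intro x hx
    obtain ⟨a, rfl⟩ := (hip x).1 hx
    have h1 := LinearMap.congr_fun hf a
    have h2 := LinearMap.congr_fun hf' a
    simp at h1 h2 ⊢
    rw [h2, h1])
  obtain ⟨k, hk⟩ := hC g (by
    apply LinearMap.ext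
    intro c
    obtain ⟨b, rfl⟩ := hp c
    have h1 := LinearMap.congr_fun hg b
    have h3 := LinearMap.congr_fun hδ (f' b)
    simp at h1 h3 ⊢
    rw [h1, h3])
  obtain ⟨h, hh⟩ := hB (f' - k ∘ₗ p) (by
    ext b
    have h1 := LinearMap.congr_fun hg b
    have h2 := LinearMap.congr_fun hk (p b)
    simp at h1 h2 ⊢
    rw [h2, h1, sub_self])
  refine ⟨h ∘ₗ i, ?_⟩
  ext a
  have h1 := LinearMap.congr_fun hh (i a)
  have h2 := LinearMap.congr_fun hf' a
  have h3 : p (i a) = 0 := (hip _).2 ⟨a, rfl⟩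
  simp [h3] at h1 h2 ⊢
  rw [h1, h2]

lemma Cls.retract (i : A →ₗ[R] B) (r : B →ₗ[R] A) (hri : r ∘ₗ i = LinearMap.id) (hB : Cls δ B) :
    Cls δ A := by
  intro f hf
  obtain ⟨h, hh⟩ := hB (f ∘ₗ r) (by rw [← LinearMap.comp_assoc, hf, LinearMap.zero_comp])
  exact ⟨h ∘ₗ i, by rw [← LinearMap.comp_assoc, hh, LinearMap.comp_assoc, hri, LinearMap.comp_id]⟩

lemma Cls.equiv (e : A ≃ₗ[R] B) (hB : Cls δ B) : Cls δ A :=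
  Cls.retract e.toLinearMap e.symm.toLinearMap (by ext; simp) hB

lemma Cls.finsupp (X : Type u) (hA : Cls δ A) : Cls δ (X →₀ A) := by
  intro f hf
  choose h hh using fun x => hA (f ∘ₗ Finsupp.lsingle x)
    (by rw [← LinearMap.comp_assoc, hf, LinearMap.zero_comp])
  refine ⟨Finsupp.lsum ℕ h, ?_⟩
  ext x a
  have := LinearMap.congr_fun (hh x) a
  simpa using this

lemma clsS_iff (hY : Module.Injective R Y) (N : Submodule R A) : ClsS δ N ↔ Cls δ N := by
  constructor
  · intro h f hf
    obtain ⟨g, hg⟩ := Module.Injective.extension_property R Y _ _ N.subtype N.subtype_injective f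
    obtain ⟨k, hk⟩ := h g (fun x hx => by
      have h1 := LinearMap.congr_fun hg ⟨x, hx⟩
      have h2 := LinearMap.congr_fun hf ⟨x, hx⟩
      simp at h1 h2
      rw [h1, h2])
    refine ⟨k ∘ₗ N.subtype, ?_⟩
    ext x
    have h1 := LinearMap.congr_fun hg x
    simp at h1 ⊢
    rw [hk _ x.2, h1]
  · intro h g hg
    obtain ⟨k, hk⟩ := h (g ∘ₗ N.subtype) (by ext x; exact hg x x.2)
    obtain ⟨k', hk'⟩ := Module.Injective.extension_property R Y _ _ N.subtype N.subtype_injective k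
    refine ⟨k', fun x hx => ?_⟩
    have h1 := LinearMap.congr_fun hk ⟨x, hx⟩
    have h2 := LinearMap.congr_fun hk' ⟨x, hx⟩
    simp at h1 h2
    rw [h2, h1]

lemma clsS_bot : ClsS δ (⊥ : Submodule R A) := fun g _ => ⟨0, fun x hx => by
  rw [(Submodule.mem_bot R).1 hx]; simp⟩

lemma ClsS.step (hδ : δ ∘ₗ δ = 0) {N' N : Submodule R A} (hle : N' ≤ N)
    (hN' : ClsS δ N') (hN : ClsS δ N) (g h : A →ₗ[R] Y) (hg : ∀ x ∈ N, δ (g x) = 0)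
    (hh : ∀ x ∈ N', δ (h x) = g x) :
    ∃ h' : A →ₗ[R] Y, (∀ x ∈ N, δ (h' x) = g x) ∧ ∀ x ∈ N', h' x = h x := by
  obtain ⟨h0, hh0⟩ := hN g hg
  obtain ⟨c, hc⟩ := hN' (h0 - h) (fun x hx => by
    simp [hh0 x (hle hx), hh x hx])
  refine ⟨h0 - δ ∘ₗ c, fun x hx => ?_, fun x hx => ?_⟩
  · have h3 := LinearMap.congr_fun hδ (c x)
    simp at h3 ⊢
    rw [h3, hh0 x hx, sub_zero]
  · simp [hc x hx]

lemma ClsS.union (hY : Module.Injective R Y) (hδ : δ ∘ₗ δ = 0) {W : Type u} [LinearOrder W]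
    [WellFoundedLT W] (N : W → Submodule R A) (hN : Monotone N)
    (h1 : ∀ a, ClsS δ (N a)) (h2 : ∀ a, ClsS δ (⨆ b : Set.Iio a, N b.1)) :
    ClsS δ (⨆ a, N a) := by
  intro g hg
  let S : Set (A →ₗ.[R] Y) := {p | p.domain ≤ (⨆ a : {a // N a ≤ p.domain}, N a.1) ∧
    ∀ x : p.domain, δ (p x) = g x}
  obtain ⟨m, -, hm⟩ := zorn_le_nonempty₀ S (by
    intro c hcS hc y hy
    have hne : c.Nonempty := ⟨y, hy⟩
    have hd := hc.directedOn
    refine ⟨LinearPMap.sSup c hd, ⟨?_, ?_⟩, fun z hz => LinearPMap.le_sSup hd hz⟩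
    · intro x hx
      obtain ⟨f, hf, hx⟩ := (LinearPMap.mem_domain_sSup_iff hne hd).1 hx
      have hle := (LinearPMap.le_sSup hd hf).1
      have := (hcS hf).1 hx
      refine (iSup_le fun a => ?_ : (⨆ a : {a // N a ≤ f.domain}, N a.1) ≤ _) this
      exact le_iSup (fun a : {a // N a ≤ (LinearPMap.sSup c hd).domain} => N a.1)
        ⟨a.1, a.2.trans hle⟩
    · rintro ⟨x, hx⟩
      obtain ⟨f, hf, hx'⟩ := (LinearPMap.mem_domain_sSup_iff hne hd).1 hx
      have h4 := LinearPMap.sSup_apply hd hf ⟨x, hx'⟩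
      have h5 := (hcS hf).2 ⟨x, hx'⟩
      rw [← h4] at h5
      exact h5) ⟨⊥, 0⟩ ⟨bot_le, by
        rintro ⟨x, hx⟩
        have : x = 0 := (Submodule.mem_bot R).1 hx
        subst this
        simp⟩
  by_cases hall : ∀ a, N a ≤ m.domain
  · obtain ⟨h, hh⟩ := Module.Injective.extension_property R Y _ _ m.domain.subtype
      m.domain.subtype_injective m.toFun
    refine ⟨h, fun x hx => ?_⟩
    have hx' : x ∈ m.domain := (iSup_le hall) hx
    have h3 := LinearMap.congr_fun hh ⟨x, hx'⟩
    have h4 := hm.prop.2 ⟨x, hx'⟩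
    simp at h3 h4
    rw [h3]; exact h4
  · exfalso
    push Not at hall
    let b := WellFounded.min (wellFounded_lt (α := W)) {a | ¬ N a ≤ m.domain} hall
    have hb : ¬ N b ≤ m.domain := WellFounded.min_mem _ {a | ¬ N a ≤ m.domain} hall
    have hlt : ∀ a, a < b → N a ≤ m.domain := fun a ha => by
      by_contra hc
      exact WellFounded.not_lt_min wellFounded_lt {a | ¬ N a ≤ m.domain} hc ha
    have hdom : m.domain = ⨆ a : Set.Iio b, N a.1 := by
      apply le_antisymm
      · refine hm.prop.1.trans (iSup_le fun a => ?_)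
        have : a.1 < b := by
          by_contra hc
          exact hb ((hN (not_lt.1 hc)).trans a.2)
        exact le_iSup (fun a : Set.Iio b => N a.1) ⟨a.1, this⟩
      · exact iSup_le fun a => hlt a.1 a.2
    have hle : m.domain ≤ N b := by
      rw [hdom]; exact iSup_le fun a => hN (le_of_lt a.2)
    obtain ⟨h, hh⟩ := Module.Injective.extension_property R Y _ _ m.domain.subtype
      m.domain.subtype_injective m.toFun
    have hh' : ∀ x (hx : x ∈ m.domain), h x = m ⟨x, hx⟩ := fun x hx =>
      LinearMap.congr_fun hh ⟨x, hx⟩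
    obtain ⟨h', e1, e2⟩ := ClsS.step hδ hle (by rw [hdom]; exact h2 b) (h1 b) g h
      (fun x hx => hg x (le_iSup N b hx)) (fun x hx => by
        rw [hh' x hx]; exact hm.prop.2 ⟨x, hx⟩)
    have hS : (h'.toPMap (N b)) ∈ S := by
      refine ⟨le_iSup (fun a : {a // N a ≤ N b} => N a.1) ⟨b, le_rfl⟩, ?_⟩
      rintro ⟨x, hx⟩
      exact e1 x hx
    have hmle : m ≤ h'.toPMap (N b) := by
      refine ⟨hle, ?_⟩
      rintro ⟨x, hx⟩ ⟨y, hy⟩ rfl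
      rw [← hh' x hx, ← e2 x hx]
      rfl
    exact hb (hm.le_of_ge hS hmle).1

lemma ClsS.finset_union (hY : Module.Injective R Y) (hδ : δ ∘ₗ δ = 0) {X : Type u}
    (v : Finset X → Submodule R A) (hv : Monotone v) (h : ∀ T, ClsS δ (v T)) (S : Set X) :
    ClsS δ (⨆ T : {T : Finset X // (T : Set X) ⊆ S}, v T.1) := by
  suffices H : ∀ c : Cardinal.{u}, ∀ S : Set X, Cardinal.mk S = c →
      ClsS δ (⨆ T : {T : Finset X // (T : Set X) ⊆ S}, v T.1) from H _ S rfl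
  intro c
  induction c using WellFoundedLT.induction with
  | ind c ih =>
  intro S hS
  by_cases hfin : S.Finite
  · have : (⨆ T : {T : Finset X // (T : Set X) ⊆ S}, v T.1) = v hfin.toFinset := by
      apply le_antisymm
      · exact iSup_le fun T => hv (by intro x hx; simpa using T.2 hx)
      · exact le_iSup (fun T : {T : Finset X // (T : Set X) ⊆ S} => v T.1)
          ⟨hfin.toFinset, by simp⟩
    rw [this]; exact h _
  have hc : Cardinal.aleph0 ≤ c := by
    rw [← hS]; exact Cardinal.infinite_iff.1 (Set.infinite_coe_iff.2 hfin)
  let W := c.ord.ToType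
  have hW : Cardinal.mk W = Cardinal.mk S := by rw [hS]; exact Cardinal.mk_ord_toType c
  obtain ⟨e⟩ := Cardinal.eq.1 hW
  have hIio : ∀ b : W, Cardinal.mk (Set.Iio b) < c := fun b => Cardinal.mk_Iio_toType_ord_lt b
  have hIic : ∀ b : W, Cardinal.mk (Set.Iic b) < c := fun b => by
    rw [← Set.Iio_insert]
    exact (Cardinal.mk_insert_le).trans_lt
      (Cardinal.add_lt_of_lt hc (hIio b) (Cardinal.one_lt_aleph0.trans_le hc))
  let im : Set W → Set X := fun V => (fun w => (e w : X)) '' V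
  have him : ∀ V, Cardinal.mk (im V) ≤ Cardinal.mk V := fun V => Cardinal.mk_image_le
  let N : W → Submodule R A := fun b => ⨆ T : {T : Finset X // (T : Set X) ⊆ im (Set.Iic b)}, v T.1
  have hNle : ∀ (b : W) (T : Finset X), (T : Set X) ⊆ im (Set.Iic b) → v T ≤ N b := fun b T hT =>
    le_iSup (fun T : {T : Finset X // (T : Set X) ⊆ im (Set.Iic b)} => v T.1) ⟨T, hT⟩
  have hNm : Monotone N := fun a b hab => iSup_le fun T => hNle b _
    (T.2.trans (Set.image_mono (Set.Iic_subset_Iic.2 hab)))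
  -- finite subsets of a nonempty set are bounded
  have hbd : ∀ (V : Set W), V.Nonempty → ∀ T : Finset X, (T : Set X) ⊆ im V →
      ∃ a ∈ V, (T : Set X) ⊆ im (Set.Iic a) := by
    classical
    intro V hV T
    induction T using Finset.induction_on with
    | empty => intro _; obtain ⟨a, ha⟩ := hV; exact ⟨a, ha, by simp⟩
    | insert x T hx iht =>
      intro hT
      rw [Finset.coe_insert, Set.insert_subset_iff] at hT
      obtain ⟨a, ha, haT⟩ := iht hT.2
      obtain ⟨w, hw, rfl⟩ := hT.1
      refine ⟨max a w, by rcases max_choice a w with h | h <;> rw [h] <;> assumption, ?_⟩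
      rw [Finset.coe_insert, Set.insert_subset_iff]
      exact ⟨⟨w, Set.mem_Iic.2 (le_max_right _ _), rfl⟩,
        haT.trans (Set.image_mono (Set.Iic_subset_Iic.2 (le_max_left _ _)))⟩
  have hSeq : (⨆ T : {T : Finset X // (T : Set X) ⊆ S}, v T.1) = ⨆ b, N b := by
    have hWne : (Set.univ : Set W).Nonempty := by
      have : Infinite S := Set.infinite_coe_iff.2 hfin
      exact ⟨e.symm (Classical.arbitrary S), trivial⟩
    apply le_antisymm
    · refine iSup_le fun T => ?_
      obtain ⟨a, -, ha⟩ := hbd Set.univ hWne T.1 (T.2.trans (by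
        intro x hx
        exact ⟨e.symm ⟨x, hx⟩, trivial, by simp⟩))
      exact (hNle a _ ha).trans (le_iSup N a)
    · refine iSup_le fun b => iSup_le fun T => ?_
      exact le_iSup (fun T : {T : Finset X // (T : Set X) ⊆ S} => v T.1) ⟨T.1, T.2.trans (by
        rintro x ⟨w, -, rfl⟩
        exact (e w).2)⟩
  rw [hSeq]
  refine ClsS.union hY hδ N hNm (fun a => ih _ ((him _).trans_lt (hIic a)) _ rfl) (fun a => ?_)
  by_cases hne : (Set.Iio a).Nonempty
  · have : (⨆ b : Set.Iio a, N b.1) = ⨆ T : {T : Finset X // (T : Set X) ⊆ im (Set.Iio a)}, v T.1 := by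
      apply le_antisymm
      · refine iSup_le fun b => iSup_le fun T => ?_
        exact le_iSup (fun T : {T : Finset X // (T : Set X) ⊆ im (Set.Iio a)} => v T.1)
          ⟨T.1, T.2.trans (Set.image_mono (fun w hw => Set.mem_Iio.2 (lt_of_le_of_lt (Set.mem_Iic.1 hw) b.2)))⟩
      · refine iSup_le fun T => ?_
        obtain ⟨b, hb, hbT⟩ := hbd _ hne T.1 T.2
        exact (hNle b _ hbT).trans (le_iSup (fun b : Set.Iio a => N b.1) ⟨b, hb⟩)
    rw [this]
    exact ih _ ((him _).trans_lt (hIio a)) _ rfl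
  · have : IsEmpty (Set.Iio a) := by
      rw [Set.not_nonempty_iff_eq_empty] at hne
      rw [hne]; infer_instance
    rw [iSup_of_empty]
    exact clsS_bot

end Part1

section Part2
variable {R : Type u} [CommRing R]

lemma lazard_good {F : Type u} [AddCommGroup F] [Module R F] [Module.Flat R F]
    (N : Submodule R ((F × ℕ) →₀ R)) (hfg : N.FG)
    (hN : N ≤ (Finsupp.linearCombination R (Prod.fst : F × ℕ → F)).ker) :
    ∃ θ : ((F × ℕ) →₀ R) →ₗ[R] ((F × ℕ) →₀ R), θ ∘ₗ θ = θ ∧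
      (Finsupp.linearCombination R (Prod.fst : F × ℕ → F)) ∘ₗ θ =
        Finsupp.linearCombination R (Prod.fst : F × ℕ → F) ∧
      (N ≤ θ.ker) ∧ θ.ker.FG := by
  classical
  set π := Finsupp.linearCombination R (Prod.fst : F × ℕ → F) with hπ
  obtain ⟨S, hS⟩ := hfg
  let U : Finset (F × ℕ) := S.biUnion (fun x => x.support)
  have hNU : N ≤ Finsupp.supported R R (U : Set (F × ℕ)) := by
    rw [← hS, Submodule.span_le]
    intro x hx
    rw [SetLike.mem_coe, Finsupp.mem_supported]
    intro y hy
    exact Finset.mem_coe.2 (Finset.mem_biUnion.2 ⟨x, hx, hy⟩)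
  let Q := Finsupp.supported R R (U : Set (F × ℕ))
  have e := Finsupp.supportedEquivFinsupp (R := R) (M := R) (U : Set (F × ℕ))
  have : Module.Free R Q := Module.Free.of_equiv e.symm
  have : Module.Finite R Q := Module.Finite.equiv e.symm
  have : Module.Finite R N := Module.Finite.of_fg ⟨S, hS⟩
  obtain ⟨k, a, y, hay, haf⟩ := Module.Flat.exists_factorization_of_comp_eq_zero_of_free
    (K := N) (N := Q) (f := Submodule.inclusion hNU) (x := π ∘ₗ Q.subtype) (by
      ext x
      exact hN x.2)
  obtain ⟨m, hm⟩ : ∃ m : ℕ, ∀ x ∈ U, x.2 < m := by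
    refine ⟨U.sup Prod.snd + 1, fun x hx => Nat.lt_succ_of_le (Finset.le_sup (f := Prod.snd) hx)⟩
  let w : Fin k → F × ℕ := fun i => (y (Finsupp.single i 1), m + i)
  have hw : ∀ i, w i ∉ U := fun i hi => by
    have := hm _ hi
    simp [w] at this
  let b : (Fin k →₀ R) →ₗ[R] ((F × ℕ) →₀ R) :=
    Finsupp.linearCombination R (fun i => Finsupp.single (w i) 1)
  have hb : π ∘ₗ b = y := by
    ext i
    simp [b, hπ, w]
  let θ : ((F × ℕ) →₀ R) →ₗ[R] ((F × ℕ) →₀ R) :=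
    Finsupp.linearCombination R (fun x => if h : x ∈ U then
      b (a ⟨Finsupp.single x 1, Finsupp.single_mem_supported R 1 h⟩) else Finsupp.single x 1)
  have hθ1 : ∀ x (h : x ∈ U), θ (Finsupp.single x 1) =
      b (a ⟨Finsupp.single x 1, Finsupp.single_mem_supported R 1 h⟩) := fun x h => by
    simp [θ, h]
  have hθ2 : ∀ x (h : x ∉ U), θ (Finsupp.single x 1) = Finsupp.single x 1 := fun x h => by
    simp [θ, h]
  have hθb : θ ∘ₗ b = b := by
    ext i : 2
    simp only [LinearMap.comp_apply, Finsupp.lsingle_apply]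
    have : b (Finsupp.single i 1) = Finsupp.single (w i) 1 := by simp [b]
    rw [this, hθ2 _ (hw i)]
  have hθQ : ∀ q : Q, θ q = b (a q) := by
    have : ∀ q ∈ Finsupp.supported R R (U : Set (F × ℕ)), ∀ h : q ∈ Q, θ q = b (a ⟨q, h⟩) := by
      rw [Finsupp.supported_eq_span_single]
      intro q hq
      induction hq using Submodule.span_induction with
      | mem x hx =>
        obtain ⟨z, hz, rfl⟩ := hx
        intro h
        exact hθ1 z hz
      | zero =>
        intro h
        have : (⟨0, h⟩ : Q) = 0 := rfl
        rw [this]; simp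
      | add x y hx hy ihx ihy =>
        intro h
        rw [← Finsupp.supported_eq_span_single] at hx hy
        have : (⟨x + y, h⟩ : Q) = ⟨x, hx⟩ + ⟨y, hy⟩ := rfl
        rw [this, map_add, map_add, map_add, ihx hx, ihy hy]
      | smul r x hx ihx =>
        intro h
        rw [← Finsupp.supported_eq_span_single] at hx
        have : (⟨r • x, h⟩ : Q) = r • ⟨x, hx⟩ := rfl
        rw [this, map_smul, map_smul, map_smul, ihx hx]
    exact fun q => this q q.2 q.2
  have hidem : θ ∘ₗ θ = θ := by
    ext x : 2
    simp only [LinearMap.comp_apply, Finsupp.lsingle_apply]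
    by_cases h : x ∈ U
    · rw [hθ1 x h]
      exact LinearMap.congr_fun hθb _
    · rw [hθ2 x h, hθ2 x h]
  refine ⟨θ, hidem, ?_, ?_, ?_⟩
  · ext x : 2
    simp only [LinearMap.comp_apply, Finsupp.lsingle_apply]
    by_cases h : x ∈ U
    · rw [hθ1 x h]
      have h1 := LinearMap.congr_fun hb (a ⟨Finsupp.single x 1, Finsupp.single_mem_supported R 1 h⟩)
      have h2 := LinearMap.congr_fun hay ⟨Finsupp.single x 1, Finsupp.single_mem_supported R 1 h⟩
      simp only [LinearMap.comp_apply] at h1 h2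
      rw [h1, ← h2]; rfl
    · rw [hθ2 x h]
  · intro x hx
    rw [LinearMap.mem_ker]
    have h1 := hθQ ⟨x, hNU hx⟩
    have h2 := LinearMap.congr_fun haf ⟨x, hx⟩
    simp only [LinearMap.comp_apply] at h2
    refine h1.trans ?_
    refine (congrArg b h2).trans ?_
    simp
  · refine ⟨U.image (fun x => Finsupp.single x 1 - θ (Finsupp.single x 1)), ?_⟩
    apply le_antisymm
    · rw [Submodule.span_le]
      intro z hz
      simp only [Finset.coe_image, Set.mem_image] at hz
      obtain ⟨x, -, rfl⟩ := hz
      have := LinearMap.congr_fun hidem (Finsupp.single x 1)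
      simp only [LinearMap.comp_apply] at this
      simp [this]
    · intro z hz
      have hz' : z = (LinearMap.id - θ : ((F × ℕ) →₀ R) →ₗ[R] ((F × ℕ) →₀ R)) z := by
        simp [LinearMap.mem_ker.1 hz]
      rw [hz']
      clear hz hz'
      induction z using Finsupp.induction_linear with
      | zero => simp
      | add f g hf hg => rw [map_add]; exact add_mem hf hg
      | single x r =>
        have : (Finsupp.single x r : (F × ℕ) →₀ R) = r • Finsupp.single x 1 := by simp
        rw [this, map_smul]
        apply Submodule.smul_mem
        by_cases h : x ∈ U
        · apply Submodule.subset_span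
          simp only [Finset.coe_image, Set.mem_image]
          exact ⟨x, h, rfl⟩
        · simp [hθ2 x h]

lemma monotone_choice {P : Type u} [AddCommGroup P] [Module R P] (K : Submodule R P)
    (good : Submodule R P → Prop)
    (H : ∀ N : Submodule R P, N.FG → N ≤ K → ∃ N', N'.FG ∧ N ≤ N' ∧ N' ≤ K ∧ good N') :
    ∃ v : Finset K → Submodule R P, Monotone v ∧ (∀ T, good (v T)) ∧ (∀ T, v T ≤ K) ∧
      ∀ T, ∀ x : K, x ∈ T → (x : P) ∈ v T := by
  classical
  choose! c h1 h2 h3 h4 using H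
  let st : (T : Finset K) → (∀ t : Finset K, t ⊂ T → Submodule R P) → Submodule R P :=
    fun T f => Submodule.span R ((fun x : K => (x : P)) '' (T : Set K)) ⊔
      ⨆ t : {t : Finset K // t ⊂ T}, f t.1 t.2
  let u : Finset K → Submodule R P := fun T =>
    Finset.strongInduction (p := fun _ => Submodule R P) (fun T f => c (st T f)) T
  have hu : ∀ T, u T = c (st T (fun t _ => u t)) := fun T => Finset.strongInduction_eq _ T
  have key : ∀ T, (st T (fun t _ => u t)).FG ∧ st T (fun t _ => u t) ≤ K := by
    intro T
    induction T using Finset.strongInduction with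
    | H T ih =>
    have hfin : Finite {t : Finset K // t ⊂ T} := by
      have : Set.Finite {t : Finset K | t ⊂ T} := by
        refine (T.ssubsets.finite_toSet).subset ?_
        intro t ht
        exact Finset.mem_coe.2 (Finset.mem_ssubsets.2 ht)
      exact this
    constructor
    · refine Submodule.FG.sup (Submodule.fg_span ((T.finite_toSet).image _)) ?_
      refine Submodule.fg_iSup _ (fun t => ?_)
      show (u t.1).FG
      rw [hu]
      exact h1 _ (ih t.1 t.2).1 (ih t.1 t.2).2
    · refine sup_le (Submodule.span_le.2 ?_) (iSup_le fun t => ?_)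
      · rintro _ ⟨x, -, rfl⟩
        exact x.2
      · show u t.1 ≤ K
        rw [hu]
        exact h3 _ (ih t.1 t.2).1 (ih t.1 t.2).2
  have hle : ∀ T, st T (fun t _ => u t) ≤ u T := fun T => by
    rw [hu T]; exact h2 _ (key T).1 (key T).2
  refine ⟨u, ?_, fun T => ?_, fun T => ?_, fun T x hx => ?_⟩
  · intro T' T hT
    rcases hT.eq_or_ssubset with h | h
    · rw [h]
    · refine le_trans ?_ (hle T)
      refine le_trans ?_ le_sup_right
      exact le_iSup (fun t : {t : Finset K // t ⊂ T} => u t.1) ⟨T', h⟩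
  · rw [hu]; exact h4 _ (key T).1 (key T).2
  · rw [hu]; exact h3 _ (key T).1 (key T).2
  · refine hle T (le_sup_left (a := Submodule.span R ((fun x : K => (x : P)) '' (T : Set K))) ?_)
    exact Submodule.subset_span ⟨x, hx, rfl⟩

open TensorProduct in
lemma Cls.tensor_aux1 {Y : Type u} [AddCommGroup Y] [Module R Y] {δ : Y →ₗ[R] Y}
    {D P : Type u} [AddCommGroup D] [Module R D] [AddCommGroup P] [Module R P]
    (hP : Cls δ (D ⊗[R] P)) (N : Submodule R P) (θ : P →ₗ[R] P)
    (h1 : ∀ x, x - θ x ∈ N) (h2 : ∀ x ∈ N, θ x = 0) :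
    Cls δ (LinearMap.range (LinearMap.lTensor D N.subtype)) := by
  let q : P →ₗ[R] N := LinearMap.codRestrict N (LinearMap.id - θ) h1
  have hq : q ∘ₗ N.subtype = LinearMap.id := by
    ext x : 1
    apply Subtype.ext
    simp [q, h2 _ x.2]
  let j := LinearMap.lTensor D N.subtype
  let r : D ⊗[R] P →ₗ[R] LinearMap.range j := j.rangeRestrict ∘ₗ LinearMap.lTensor D q
  refine Cls.retract (LinearMap.range j).subtype r ?_ hP
  apply LinearMap.ext
  rintro ⟨z, w, rfl⟩
  apply Subtype.ext
  have h3 : LinearMap.lTensor D q (j w) = w := by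
    have : LinearMap.lTensor D q ∘ₗ j = LinearMap.id := by
      rw [← LinearMap.lTensor_comp, hq, LinearMap.lTensor_id]
    exact LinearMap.congr_fun this w
  show j (LinearMap.lTensor D q (j w)) = j w
  rw [h3]

open TensorProduct in
lemma Cls.tensor_aux2 {Y : Type u} [AddCommGroup Y] [Module R Y] {δ : Y →ₗ[R] Y}
    (hY : Module.Injective R Y) (hδ : δ ∘ₗ δ = 0)
    {D P F : Type u} [AddCommGroup D] [Module R D] [AddCommGroup P] [Module R P]
    [AddCommGroup F] [Module R F]
    (hP : Cls δ (D ⊗[R] P)) (π : P →ₗ[R] F) (hπ : Function.Surjective π)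
    (v : Finset π.ker → Submodule R P) (hv : Monotone v)
    (hgood : ∀ T, ∃ θ : P →ₗ[R] P, (∀ x, x - θ x ∈ v T) ∧ ∀ x ∈ v T, θ x = 0)
    (hvK : ∀ T, v T ≤ π.ker) (hmem : ∀ T, ∀ x : π.ker, x ∈ T → (x : P) ∈ v T) :
    Cls δ (D ⊗[R] F) := by
  let V : Finset π.ker → Submodule R (D ⊗[R] P) := fun T =>
    LinearMap.range (LinearMap.lTensor D (v T).subtype)
  have hV : ∀ T, ClsS δ (V T) := by
    intro T
    rw [clsS_iff hY]
    obtain ⟨θ, h1, h2⟩ := hgood T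
    exact Cls.tensor_aux1 hP _ θ h1 h2
  have hVm : Monotone V := by
    intro T' T h
    rintro _ ⟨z, rfl⟩
    refine ⟨LinearMap.lTensor D (Submodule.inclusion (hv h)) z, ?_⟩
    rw [← LinearMap.comp_apply, ← LinearMap.lTensor_comp]
    rfl
  have hU := ClsS.finset_union hY hδ V hVm hV Set.univ
  have hex : Function.Exact (LinearMap.lTensor D π.ker.subtype) (LinearMap.lTensor D π) :=
    lTensor_exact D (LinearMap.exact_subtype_ker_map π) hπ
  have hK : (⨆ T : {T : Finset π.ker // (T : Set π.ker) ⊆ Set.univ}, V T.1) =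
      LinearMap.ker (LinearMap.lTensor D π) := by
    rw [hex.linearMap_ker_eq]
    apply le_antisymm
    · refine iSup_le fun T => ?_
      rintro _ ⟨z, rfl⟩
      refine ⟨LinearMap.lTensor D (Submodule.inclusion (hvK T)) z, ?_⟩
      rw [← LinearMap.comp_apply, ← LinearMap.lTensor_comp]
      rfl
    · rintro _ ⟨z, rfl⟩
      induction z using TensorProduct.induction_on with
      | zero => simp
      | add x y hx hy => rw [map_add]; exact add_mem hx hy
      | tmul d x =>
        refine Submodule.mem_iSup_of_mem ⟨{x}, Set.subset_univ _⟩ ?_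
        exact ⟨d ⊗ₜ ⟨x, hmem {x} x (by simp)⟩, rfl⟩
  rw [hK, clsS_iff hY] at hU
  exact Cls.coker hY hδ (LinearMap.ker (LinearMap.lTensor D π)).subtype (LinearMap.lTensor D π)
    (Submodule.subtype_injective _) (LinearMap.lTensor_surjective D hπ)
    (LinearMap.exact_subtype_ker_map _) hU hP

open TensorProduct in
lemma Cls.tensor_flat {Y : Type u} [AddCommGroup Y] [Module R Y] {δ : Y →ₗ[R] Y}
    (hY : Module.Injective R Y) (hδ : δ ∘ₗ δ = 0)
    {D : Type u} [AddCommGroup D] [Module R D] (hD : Cls δ D)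
    (F : Type u) [AddCommGroup F] [Module R F] [Module.Flat R F] :
    Cls δ (D ⊗[R] F) := by
  classical
  let π : ((F × ℕ) →₀ R) →ₗ[R] F := Finsupp.linearCombination R (Prod.fst : F × ℕ → F)
  have hπ : Function.Surjective π := fun x => ⟨Finsupp.single (x, 0) 1,
    (Finsupp.linearCombination_single R _ _).trans (one_smul R x)⟩
  have hP : Cls δ (D ⊗[R] ((F × ℕ) →₀ R)) :=
    Cls.equiv (TensorProduct.finsuppScalarRight R R D (F × ℕ)) (Cls.finsupp _ hD)
  obtain ⟨v, hv, hgood, hvK, hmem⟩ := monotone_choice π.ker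
    (fun N' => ∃ θ : ((F × ℕ) →₀ R) →ₗ[R] ((F × ℕ) →₀ R),
      (∀ x, x - θ x ∈ N') ∧ ∀ x ∈ N', θ x = 0) (by
      intro N hfg hN
      obtain ⟨θ, h1, h2, h3, h4⟩ := lazard_good N hfg hN
      refine ⟨θ.ker, h4, h3, ?_, θ, ?_, fun x hx => hx⟩
      · intro x hx
        have := LinearMap.congr_fun h2 x
        rw [LinearMap.mem_ker]
        refine this.symm.trans ?_
        simp only [LinearMap.comp_apply]
        rw [LinearMap.mem_ker.1 hx, map_zero]
      · intro x
        have := LinearMap.congr_fun h1 x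
        simp only [LinearMap.comp_apply] at this
        simp [this])
  exact Cls.tensor_aux2 hY hδ hP π hπ v hv hgood hvK hmem
end Part2

section Part3
open TensorProduct
variable {R : Type u} [CommRing R]

/-- tensor evaluation -/
noncomputable def evt (M I E : Type u) [AddCommGroup M] [Module R M] [AddCommGroup I] [Module R I]
    [AddCommGroup E] [Module R E] :
    M ⊗[R] (I →ₗ[R] E) →ₗ[R] ((M →ₗ[R] I) →ₗ[R] E) :=
  TensorProduct.lift (LinearMap.mk₂ R (fun (m : M) (φ : I →ₗ[R] E) => φ ∘ₗ LinearMap.applyₗ m)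
    (fun m₁ m₂ φ => by ext; simp) (fun c m φ => by ext; simp)
    (fun m φ₁ φ₂ => by ext; simp) (fun c m φ => by ext; simp))

variable {M M' I E : Type u} [AddCommGroup M] [Module R M] [AddCommGroup M'] [Module R M']
    [AddCommGroup I] [Module R I] [AddCommGroup E] [Module R E]

lemma evt_tmul (m : M) (φ : I →ₗ[R] E) (g : M →ₗ[R] I) : evt M I E (m ⊗ₜ φ) g = φ (g m) := rfl

lemma evt_nat (p : M →ₗ[R] M') (z : M ⊗[R] (I →ₗ[R] E)) (g : M' →ₗ[R] I) :
    evt M' I E (LinearMap.rTensor _ p z) g = evt M I E z (g ∘ₗ p) := by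
  induction z using TensorProduct.induction_on with
  | zero => simp
  | add x y hx hy => simp only [map_add, LinearMap.add_apply, hx, hy]
  | tmul m φ => rfl

/-- inverse of tensor evaluation on finite free modules -/
noncomputable def evtInv {n : ℕ} (ψ : ((Fin n → R) →ₗ[R] I) →ₗ[R] E) :
    (Fin n → R) ⊗[R] (I →ₗ[R] E) :=
  ∑ i : Fin n, (Pi.single i 1 : Fin n → R) ⊗ₜ[R]
    (ψ ∘ₗ ((LinearMap.proj i : (Fin n → R) →ₗ[R] R).lcomp R I ∘ₗ
      (LinearMap.ringLmapEquivSelf R R I).symm.toLinearMap))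

lemma evt_inv_apply {n : ℕ} (ψ : ((Fin n → R) →ₗ[R] I) →ₗ[R] E) :
    evt _ I E (evtInv ψ) = ψ := by
  ext g
  simp only [evtInv, map_sum, LinearMap.sum_apply, evt_tmul, LinearMap.comp_apply]
  rw [← map_sum]
  congr 1
  ext i
  simp [Pi.single_apply, LinearMap.lcomp_apply]

lemma evtInv_add {n : ℕ} (ψ ψ' : ((Fin n → R) →ₗ[R] I) →ₗ[R] E) :
    evtInv (ψ + ψ') = evtInv ψ + evtInv ψ' := by
  simp only [evtInv, LinearMap.add_comp, TensorProduct.tmul_add, Finset.sum_add_distrib]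

lemma evtInv_evt {n : ℕ} (z : (Fin n → R) ⊗[R] (I →ₗ[R] E)) :
    evtInv (evt _ I E z) = z := by
  induction z using TensorProduct.induction_on with
  | zero => simp [evtInv]
  | add x y hx hy => rw [map_add, evtInv_add, hx, hy]
  | tmul m φ =>
    have : ∀ i, ((evt (Fin n → R) I E (m ⊗ₜ φ)) ∘ₗ
      ((LinearMap.proj i : (Fin n → R) →ₗ[R] R).lcomp R I ∘ₗ
      (LinearMap.ringLmapEquivSelf R R I).symm.toLinearMap)) = m i • φ := by
      intro i
      ext x
      simp [evt_tmul, LinearMap.lcomp_apply]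
    simp only [evtInv, this]
    simp_rw [← TensorProduct.smul_tmul, ← TensorProduct.sum_tmul]
    congr 1
    ext i
    simp [Finset.sum_apply, Pi.single_apply]

lemma evt_surjective [Module.Finite R M] (hE : Module.Injective R E) :
    Function.Surjective (evt (R := R) M I E) := by
  intro ψ
  obtain ⟨n, p, hp⟩ := Module.Finite.exists_fin' R M
  obtain ⟨ψ', hψ'⟩ := Module.Injective.extension_property R E _ _ (p.lcomp R I) (by
    intro g g' h
    apply LinearMap.ext
    intro x
    obtain ⟨y, rfl⟩ := hp x
    exact LinearMap.congr_fun h y) ψ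
  refine ⟨LinearMap.rTensor _ p (evtInv ψ'), ?_⟩
  ext g
  rw [evt_nat, evt_inv_apply]
  exact LinearMap.congr_fun hψ' g

lemma evt_injective [IsNoetherianRing R] [Module.Finite R M] (hE : Module.Injective R E) :
    Function.Injective (evt (R := R) M I E) := by
  rw [injective_iff_map_eq_zero]
  intro z hz
  obtain ⟨n, p, hp⟩ := Module.Finite.exists_fin' R M
  obtain ⟨w, rfl⟩ := LinearMap.rTensor_surjective (I →ₗ[R] E) hp z
  let res : ((Fin n → R) →ₗ[R] I) →ₗ[R] (p.ker →ₗ[R] I) := p.ker.subtype.lcomp R I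
  obtain ⟨ψ0, hψ0⟩ := factor_surj (res.rangeRestrict) res.surjective_rangeRestrict
    (evt _ I E w) (by
      intro g hg
      have hg : ∀ x, p x = 0 → g x = 0 := fun x hx =>
        LinearMap.congr_fun (congrArg Subtype.val hg) ⟨x, hx⟩
      obtain ⟨g', hg'⟩ := factor_surj p hp g hg
      rw [← hg', ← evt_nat, hz, LinearMap.zero_apply])
  obtain ⟨ψ, hψ⟩ := Module.Injective.extension_property R E _ _ res.range.subtype
    (Submodule.subtype_injective _) ψ0
  obtain ⟨v, hv⟩ := evt_surjective (M := p.ker) hE ψ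
  have h1 : evt _ I E (LinearMap.rTensor _ p.ker.subtype v) = evt _ I E w := by
    ext g : 1
    rw [evt_nat, hv, ← hψ0]
    exact LinearMap.congr_fun hψ (res.rangeRestrict g)
  have h2 : LinearMap.rTensor _ p.ker.subtype v = w := by
    rw [← evtInv_evt w, ← h1, evtInv_evt]
  rw [← h2, ← LinearMap.comp_apply, ← LinearMap.rTensor_comp]
  have : p ∘ₗ p.ker.subtype = 0 := by ext x; exact x.2
  rw [this, LinearMap.rTensor_zero, LinearMap.zero_apply]

lemma flat_hom [IsNoetherianRing R] (hI : Module.Injective R I) (hE : Module.Injective R E) :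
    Module.Flat R (I →ₗ[R] E) := by
  rw [Module.Flat.iff_rTensor_injective]
  intro J _
  rw [injective_iff_map_eq_zero]
  intro z hz
  apply evt_injective hE
  rw [map_zero]
  ext g
  obtain ⟨g', hg'⟩ := Module.Injective.extension_property R I _ _ J.subtype
    (Submodule.subtype_injective _) g
  rw [← hg', ← evt_nat, hz]
  simp

lemma Cls.hom_hom [IsNoetherianRing R] {Y : Type u} [AddCommGroup Y] [Module R Y] {δ : Y →ₗ[R] Y}
    (hY : Module.Injective R Y) (hδ : δ ∘ₗ δ = 0)
    {D : Type u} [AddCommGroup D] [Module R D] [Module.Finite R D] (hD : Cls δ D)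
    (hI : Module.Injective R I) (hE : Module.Injective R E) :
    Cls δ ((D →ₗ[R] I) →ₗ[R] E) := by
  have := flat_hom hI hE
  refine Cls.equiv (LinearEquiv.ofBijective (evt D I E) ⟨evt_injective hE, evt_surjective hE⟩).symm
    (Cls.tensor_flat hY hδ hD (I →ₗ[R] E))
end Part3

section Part4
open CategoryTheory.Limits
variable {R : Type u} [CommRing R]

/-- elementary form of the vanishing of `Ext^{i+1}(L, M)` -/
def EV (i : ℕ) (L M : ModuleCat.{u} R) : Prop :=
  ∀ φ : (projectiveResolution L).complex.X (i + 1) ⟶ M,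
    (projectiveResolution L).complex.d (i + 2) (i + 1) ≫ φ = 0 →
    ∃ ψ : (projectiveResolution L).complex.X i ⟶ M,
      (projectiveResolution L).complex.d (i + 1) i ≫ ψ = φ

lemma EV.of_isZero (i : ℕ) (L M : ModuleCat.{u} R)
    (h : IsZero (((Ext R (ModuleCat.{u} R) (i + 1)).obj (Opposite.op L)).obj M)) : EV i L M := by
  have h1 := IsZero.of_iso h ((projectiveResolution L).isoExt (R := R) (i + 1) M).symm
  rw [← HomologicalComplex.exactAt_iff_isZero_homology,
    HomologicalComplex.exactAt_iff' _ i (i + 1) (i + 2) (by simp) (by simp),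
    ShortComplex.moduleCat_exact_iff] at h1
  intro φ hφ
  obtain ⟨ψ, hψ⟩ := h1 φ hφ
  exact ⟨ψ, hψ⟩

lemma EV.shift {S : ShortComplex (ModuleCat.{u} R)} (hS : S.ShortExact) [Injective S.X₂]
    (i : ℕ) (L : ModuleCat.{u} R) (h : EV (i + 1) L S.X₁) : EV i L S.X₃ := by
  intro φ hφ
  let P := projectiveResolution L
  have := hS.mono_f
  have := hS.epi_g
  let φ' : P.complex.X (i + 1) ⟶ S.X₂ := Projective.factorThru φ S.g
  have hφ' : φ' ≫ S.g = φ := Projective.factorThru_comp φ S.g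
  let χ := hS.exact.lift (P.complex.d (i + 2) (i + 1) ≫ φ') (by
    rw [Category.assoc, hφ']; exact hφ)
  have hχ : χ ≫ S.f = P.complex.d (i + 2) (i + 1) ≫ φ' := hS.exact.lift_f _ _
  obtain ⟨ψ, hψ⟩ := h χ (by
    rw [← cancel_mono S.f, Category.assoc]
    erw [hχ]
    rw [zero_comp]
    erw [HomologicalComplex.d_comp_d_assoc, zero_comp])
  have hz : P.complex.d (i + 2) (i + 1) ≫ (φ' - ψ ≫ S.f) = 0 := by
    rw [Preadditive.comp_sub, ← hχ, ← hψ, Category.assoc, sub_self]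
  refine ⟨(P.exact_succ i).descToInjective (φ' - ψ ≫ S.f) hz ≫ S.g, ?_⟩
  have h4 := (P.exact_succ i).comp_descToInjective (φ' - ψ ≫ S.f) hz
  have h5 := congrArg (fun t => t ≫ S.g) h4
  simp only [Category.assoc, Preadditive.sub_comp, S.zero, comp_zero, sub_zero, hφ'] at h5
  exact h5

lemma EV.lift {S : ShortComplex (ModuleCat.{u} R)} (hS : S.ShortExact)
    (L : ModuleCat.{u} R) (h : EV 0 L S.X₁) (f : L ⟶ S.X₃) : ∃ k : L ⟶ S.X₂, k ≫ S.g = f := by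
  let P := projectiveResolution L
  have := hS.mono_f
  have := hS.epi_g
  let π : P.complex.X 0 ⟶ L := P.π.f 0
  have hπ : P.complex.d 1 0 ≫ π = 0 := P.complex_d_comp_π_f_zero
  have hepi : Epi π := inferInstanceAs (Epi (P.π.f 0))
  let φ' : P.complex.X 0 ⟶ S.X₂ := Projective.factorThru (π ≫ f) S.g
  have hφ' : φ' ≫ S.g = π ≫ f := Projective.factorThru_comp _ S.g
  let χ := hS.exact.lift (P.complex.d 1 0 ≫ φ') (by
    rw [Category.assoc, hφ', ← Category.assoc, hπ, zero_comp])
  have hχ : χ ≫ S.f = P.complex.d 1 0 ≫ φ' := hS.exact.lift_f _ _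
  obtain ⟨ψ, hψ⟩ := h χ (by
    rw [← cancel_mono S.f, Category.assoc]
    erw [hχ]
    rw [zero_comp]
    erw [HomologicalComplex.d_comp_d_assoc, zero_comp])
  have hz : P.complex.d 1 0 ≫ (φ' - ψ ≫ S.f) = 0 := by
    rw [Preadditive.comp_sub, ← hχ, ← hψ, Category.assoc, sub_self]
  obtain ⟨k, hk⟩ := CokernelCofork.IsColimit.desc' P.isColimitCokernelCofork _ hz
  refine ⟨k, ?_⟩
  rw [← cancel_epi π, ← hφ']
  have h5 := congrArg (fun t => t ≫ S.g) hk
  simp only [Category.assoc, Preadditive.sub_comp, S.zero, comp_zero, sub_zero] at h5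
  exact h5

/-- `M` has a finite injective resolution that stays exact under `Hom(D, -)` -/
def ResN (D : Type u) [AddCommGroup D] [Module R D] : ℕ → ModuleCat.{u} R → Prop
  | 0, M => Module.Injective R M
  | n + 1, M => ∃ (I C : ModuleCat.{u} R) (i : M →ₗ[R] I) (p : I →ₗ[R] C),
      Module.Injective R I ∧ Function.Injective i ∧ Function.Surjective p ∧ Function.Exact i p ∧
      (∀ f : D →ₗ[R] C, ∃ k : D →ₗ[R] I, p ∘ₗ k = f) ∧ ResN D n C

lemma resN_of_ev (D : Type u) [AddCommGroup D] [Module R D] (n : ℕ) (M : ModuleCat.{u} R)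
    (h1 : ∀ L, ∀ i, n ≤ i → EV i L M) (h2 : ∀ i, EV i (ModuleCat.of R D) M) : ResN D n M := by
  have key : ∀ M : ModuleCat.{u} R, ∃ S : ShortComplex (ModuleCat.{u} R), S.ShortExact ∧
      Injective S.X₂ ∧ S.X₁ = M := fun M => by
    let S : ShortComplex (ModuleCat.{u} R) :=
      ShortComplex.mk (Injective.ι M) (cokernel.π (Injective.ι M)) (by simp)
    have hex : S.Exact := ShortComplex.exact_of_g_is_cokernel _ (cokernelIsCokernel _)
    refine ⟨S, ?_, ?_, rfl⟩
    · have : Mono S.f := inferInstanceAs (Mono (Injective.ι M))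
      have : Epi S.g := inferInstanceAs (Epi (cokernel.π (Injective.ι M)))
      exact ShortComplex.ShortExact.mk hex
    · exact inferInstanceAs (Injective (Injective.under M))
  induction n generalizing M with
  | zero =>
    obtain ⟨S, hS, hI, rfl⟩ := key M
    obtain ⟨k, hk⟩ := EV.lift hS S.X₃ (h1 _ 0 le_rfl) (𝟙 _)
    have := hS.mono_f
    have hr : ∃ r : S.X₂ ⟶ S.X₁, S.f ≫ r = 𝟙 _ := by
      refine ⟨hS.exact.lift (𝟙 _ - S.g ≫ k) (by simp [hk]), ?_⟩
      rw [← cancel_mono S.f, Category.assoc, ShortComplex.Exact.lift_f]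
      simp
    obtain ⟨r, hr⟩ := hr
    have : Injective S.X₁ := (Retract.mk S.f r hr).injective
    exact Module.injective_module_of_injective_object R S.X₁
  | succ n ih =>
    obtain ⟨S, hS, hI, rfl⟩ := key M
    refine ⟨S.X₂, S.X₃, S.f.hom, S.g.hom, Module.injective_module_of_injective_object R S.X₂,
      ?_, ?_, ?_, ?_, ?_⟩
    · exact hS.moduleCat_injective_f
    · exact hS.moduleCat_surjective_g
    · exact (ShortComplex.ShortExact.moduleCat_exact_iff_function_exact S).1 hS.exact
    · intro f
      obtain ⟨k, hk⟩ := EV.lift hS (ModuleCat.of R D) (h2 0) (ModuleCat.ofHom f)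
      exact ⟨k.hom, by rw [← ModuleCat.hom_comp, hk]; rfl⟩
    · apply ih
      · intro L i hi
        exact EV.shift hS i L (h1 L (i + 1) (by omega))
      · intro i
        exact EV.shift hS i _ (h2 (i + 1))

lemma IsDualizingModule.resN {D : Type u} [AddCommGroup D] [Module R D]
    (hD : IsDualizingModule R D) : ∃ n, ResN D n (ModuleCat.of R D) := by
  obtain ⟨-, ⟨n, hn⟩, -, h⟩ := hD
  refine ⟨n, resN_of_ev D n _ ?_ ?_⟩
  · intro L i hi
    exact EV.of_isZero _ _ _ (hn L _ _ (i + 1) (by omega))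
  · intro i
    exact EV.of_isZero _ _ _ (h (i + 1) (by omega))
end Part4

section Part5
variable {R : Type u} [CommRing R]

lemma core_aux [IsNoetherianRing R] {Y : Type u} [AddCommGroup Y] [Module R Y] {δ : Y →ₗ[R] Y}
    (hY : Module.Injective R Y) (hδ : δ ∘ₗ δ = 0)
    {D : Type u} [AddCommGroup D] [Module R D] [Module.Finite R D] (hD : Cls δ D)
    {E : Type u} [AddCommGroup E] [Module R E] (hE : Module.Injective R E)
    (n : ℕ) (M : ModuleCat.{u} R) (hM : ResN D n M) : Cls δ ((D →ₗ[R] M) →ₗ[R] E) := by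
  induction n generalizing M with
  | zero => exact Cls.hom_hom hY hδ hD hM hE
  | succ n ih =>
    obtain ⟨I, C, i, p, hI, hi, hp, hip, hl, hC⟩ := hM
    let i' : (D →ₗ[R] M) →ₗ[R] (D →ₗ[R] I) := LinearMap.compRight R i
    let p' : (D →ₗ[R] I) →ₗ[R] (D →ₗ[R] C) := LinearMap.compRight R p
    have hp' : Function.Surjective p' := hl
    have hi' : Function.Injective i' := by
      intro f g h
      ext x
      exact hi (LinearMap.congr_fun h x)
    refine Cls.coker hY hδ (p'.lcomp R E) (i'.lcomp R E) ?_ ?_ ?_ (ih C hC)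
      (Cls.hom_hom hY hδ hD hI hE)
    · intro f g h
      apply LinearMap.ext
      intro x
      obtain ⟨y, rfl⟩ := hp' x
      exact LinearMap.congr_fun h y
    · intro f
      obtain ⟨g, hg⟩ := Module.Injective.extension_property R E _ _ i' hi' f
      exact ⟨g, hg⟩
    · intro ψ
      constructor
      · intro hψ
        obtain ⟨g, hg⟩ := factor_surj p' hp' ψ (by
          intro x hx
          have : ∃ y : D →ₗ[R] M, i' y = x := by
            have hx' : ∀ t, p (x t) = 0 := fun t => LinearMap.congr_fun hx t
            have hr : ∀ t, x t ∈ LinearMap.range i := fun t => (hip _).1 (hx' t)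
            let e := LinearEquiv.ofInjective i hi
            refine ⟨e.symm.toLinearMap ∘ₗ LinearMap.codRestrict (LinearMap.range i) x hr, ?_⟩
            ext t
            have := e.apply_symm_apply (LinearMap.codRestrict (LinearMap.range i) x hr t)
            exact congrArg Subtype.val this
          obtain ⟨y, rfl⟩ := this
          exact LinearMap.congr_fun hψ y)
        exact ⟨g, hg⟩
      · rintro ⟨g, rfl⟩
        ext y
        have : p' (i' y) = 0 := by
          ext t
          exact (hip _).2 ⟨y t, rfl⟩
        show g (p' (i' y)) = 0
        rw [this, map_zero]

lemma core [IsNoetherianRing R] {Y : Type u} [AddCommGroup Y] [Module R Y] {δ : Y →ₗ[R] Y}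
    (hY : Module.Injective R Y) (hδ : δ ∘ₗ δ = 0)
    {D : Type u} [AddCommGroup D] [Module R D] (hDD : IsDualizingModule R D) (hD : Cls δ D)
    (E : Type u) [AddCommGroup E] [Module R E] (hE : Module.Injective R E) : Cls δ E := by
  obtain ⟨n, hn⟩ := hDD.resN
  have := hDD.1
  have h1 := core_aux hY hδ hD hE n _ hn
  have hb := hDD.2.2.1
  let hom : R →ₗ[R] (D →ₗ[R] D) := LinearMap.toSpanSingleton R _ LinearMap.id
  let e : R ≃ₗ[R] (D →ₗ[R] D) := LinearEquiv.ofBijective hom hb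
  refine Cls.equiv ?_ h1
  exact (LinearMap.ringLmapEquivSelf R R E).symm ≪≫ₗ LinearEquiv.congrLeft E R e

lemma cls_of_resN {Y : Type u} [AddCommGroup Y] [Module R Y] {δ : Y →ₗ[R] Y}
    (hY : Module.Injective R Y) (hδ : δ ∘ₗ δ = 0)
    (H : ∀ (E : Type u) [AddCommGroup E] [Module R E], Module.Injective R E → Cls δ E)
    {D : Type u} [AddCommGroup D] [Module R D]
    (n : ℕ) (M : ModuleCat.{u} R) (hM : ResN D n M) : Cls δ M := by
  induction n generalizing M with
  | zero => exact H M hM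
  | succ n ih =>
    obtain ⟨I, C, i, p, hI, hi, hp, hip, hl, hC⟩ := hM
    exact Cls.ker hY i p hi hp hip hδ (H I hI) (ih C hC)

section prod
variable {E : ℤ → Type u} [∀ i, AddCommGroup (E i)] [∀ i, Module R (E i)]

/-- the total differential -/
def tot (d : ∀ i : ℤ, E (i + 1) →ₗ[R] E i) : (∀ i, E i) →ₗ[R] (∀ i, E i) :=
  LinearMap.pi (fun i => d i ∘ₗ LinearMap.proj (i + 1))

lemma tot_apply (d : ∀ i : ℤ, E (i + 1) →ₗ[R] E i) (x : ∀ i, E i) (i : ℤ) :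
    tot d x i = d i (x (i + 1)) := rfl

lemma tot_tot (d : ∀ i : ℤ, E (i + 1) →ₗ[R] E i) (hd : ∀ i x, d i (d (i + 1) x) = 0) :
    tot d ∘ₗ tot d = 0 := by
  apply LinearMap.ext
  intro x
  funext i
  exact hd i _

lemma cls_tot_iff (d : ∀ i : ℤ, E (i + 1) →ₗ[R] E i)
    (L : Type u) [AddCommGroup L] [Module R L] :
    Cls (tot d) L ↔ ∀ (i : ℤ) (f : L →ₗ[R] E (i + 1)), (d i) ∘ₗ f = 0 →
      ∃ h : L →ₗ[R] E (i + 1 + 1), (d (i + 1)) ∘ₗ h = f := by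
  constructor
  · intro H i f hf
    obtain ⟨h, hh⟩ := H (LinearMap.single R E (i + 1) ∘ₗ f) (by
      apply LinearMap.ext
      intro x
      funext j
      show d j ((Pi.single (i + 1) (f x) : ∀ i, E i) (j + 1)) = 0
      by_cases hj : j = i
      · subst hj
        rw [Pi.single_eq_same]
        exact LinearMap.congr_fun hf x
      · rw [Pi.single_eq_of_ne (by omega), map_zero])
    refine ⟨LinearMap.proj (i + 1 + 1) ∘ₗ h, ?_⟩
    apply LinearMap.ext
    intro x
    have := congrFun (LinearMap.congr_fun hh x) (i + 1)
    refine this.trans ?_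
    show (Pi.single (i + 1) (f x) : ∀ i, E i) (i + 1) = f x
    rw [Pi.single_eq_same]
  · intro H F hF
    have key : ∀ k, ∃ g : L →ₗ[R] E k, ∀ j (e : k = j + 1),
        d j ∘ₗ (e ▸ g : L →ₗ[R] E (j + 1)) = LinearMap.proj j ∘ₗ F := by
      intro k
      obtain ⟨i, rfl⟩ : ∃ i, k = i + 1 + 1 := ⟨k - 2, by ring⟩
      obtain ⟨h, hh⟩ := H i (LinearMap.proj (i + 1) ∘ₗ F) (by
        ext x
        exact congrFun (LinearMap.congr_fun hF x) i)
      refine ⟨h, fun j e => ?_⟩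
      obtain rfl : j = i + 1 := by omega
      exact hh
    choose g hg using key
    refine ⟨LinearMap.pi g, ?_⟩
    apply LinearMap.ext
    intro x
    funext j
    exact LinearMap.congr_fun (hg (j + 1) j rfl) x
end prod
end Part5

section Part6
variable {R : Type u} [CommRing R]

/-- torsion with respect to a multiplicative family of ideals -/
def gamA (A : Submonoid (Ideal R)) (M : Type u) [AddCommGroup M] [Module R M] :
    Submodule R M where
  carrier := {x | ∃ a ∈ A, ∀ r ∈ a, r • x = 0}
  zero_mem' := ⟨1, A.one_mem, fun r _ => smul_zero r⟩
  add_mem' := by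
    rintro x y ⟨a, ha, hx⟩ ⟨b, hb, hy⟩
    refine ⟨a * b, A.mul_mem ha hb, fun r hr => ?_⟩
    have h1 : a * b ≤ a := Ideal.mul_le_left
    have h2 : a * b ≤ b := Ideal.mul_le_right
    rw [smul_add, hx r (h1 hr), hy r (h2 hr), add_zero]
  smul_mem' := by
    rintro c x ⟨a, ha, hx⟩
    exact ⟨a, ha, fun r hr => by rw [smul_comm, hx r hr, smul_zero]⟩

variable {Y : Type u} [AddCommGroup Y] [Module R Y]
variable {L : Type u} [AddCommGroup L] [Module R L]

lemma mem_gamA {A : Submonoid (Ideal R)} {x : Y} :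
    x ∈ gamA A Y ↔ ∃ a ∈ A, ∀ r ∈ a, r • x = 0 := Iff.rfl

lemma gamA_map {A : Submonoid (Ideal R)} (f : L →ₗ[R] Y) {x : L} (hx : x ∈ gamA A L) :
    f x ∈ gamA A Y := by
  obtain ⟨a, ha, h⟩ := hx
  exact ⟨a, ha, fun r hr => by rw [← map_smul, h r hr, map_zero]⟩

lemma gamA_fg {A : Submonoid (Ideal R)} {N : Submodule R Y} (hfg : N.FG) (hN : N ≤ gamA A Y) :
    ∃ a ∈ A, ∀ r ∈ a, ∀ x ∈ N, r • x = 0 := by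
  induction N, hfg using Submodule.fg_induction with
  | singleton x =>
    obtain ⟨a, ha, h⟩ := hN (Submodule.mem_span_singleton_self x)
    refine ⟨a, ha, fun r hr y hy => ?_⟩
    obtain ⟨c, rfl⟩ := Submodule.mem_span_singleton.1 hy
    rw [smul_comm, h r hr, smul_zero]
  | sup N₁ N₂ _ _ h1 h2 =>
    obtain ⟨a, ha, h⟩ := h1 (le_sup_left.trans hN)
    obtain ⟨b, hb, h'⟩ := h2 (le_sup_right.trans hN)
    refine ⟨a * b, A.mul_mem ha hb, fun r hr y hy => ?_⟩
    obtain ⟨y1, hy1, y2, hy2, rfl⟩ := Submodule.mem_sup.1 hy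
    have e1 : a * b ≤ a := Ideal.mul_le_left
    have e2 : a * b ≤ b := Ideal.mul_le_right
    rw [smul_add, h r (e1 hr) _ hy1, h' r (e2 hr) _ hy2, add_zero]

lemma gamA_fg_map {A : Submonoid (Ideal R)} [Module.Finite R L] (f : L →ₗ[R] Y)
    (hf : ∀ t, f t ∈ gamA A Y) : ∃ a ∈ A, ∀ r ∈ a, ∀ t, r • f t = 0 := by
  obtain ⟨a, ha, h⟩ := gamA_fg (A := A) (N := LinearMap.range f)
    (by rw [LinearMap.range_eq_map]; exact Submodule.FG.map f Module.Finite.fg_top) (by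
      rintro _ ⟨t, rfl⟩; exact hf t)
  exact ⟨a, ha, fun r hr t => h r hr _ ⟨t, rfl⟩⟩

/-- Baer's criterion for submodules -/
def InjS (N : Submodule R Y) : Prop :=
  ∀ (J : Ideal R) (g : J →ₗ[R] Y), (∀ j, g j ∈ N) → ∃ y ∈ N, ∀ j : J, g j = (j : R) • y

lemma InjS.top (hY : Module.Injective R Y) : InjS (⊤ : Submodule R Y) := by
  intro J g _
  obtain ⟨g', hg'⟩ := Module.Baer.of_injective hY J g
  refine ⟨g' 1, trivial, fun j => ?_⟩
  rw [← hg' j j.2, ← map_smul, smul_eq_mul, mul_one]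

lemma InjS.injective {N : Submodule R Y} (h : InjS N) : Module.Injective R N := by
  apply Module.Baer.injective
  intro J g
  obtain ⟨y, hy, hg⟩ := h J (N.subtype ∘ₗ g) (fun j => (g j).2)
  refine ⟨LinearMap.toSpanSingleton R N ⟨y, hy⟩, fun x hx => ?_⟩
  apply Subtype.ext
  exact (hg ⟨x, hx⟩).symm

lemma InjS.glue {N : Submodule R Y} (h : InjS N) (J K : Ideal R) (g : J →ₗ[R] Y)
    (hg : ∀ j, g j ∈ N) (hz : ∀ j : J, (j : R) ∈ K → g j = 0) :
    ∃ y ∈ N, (∀ j : J, g j = (j : R) • y) ∧ ∀ k ∈ K, k • y = 0 := by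
  let f1 : R →ₗ.[R] Y := ⟨J, g⟩
  let f2 : R →ₗ.[R] Y := ⟨K, 0⟩
  have H : ∀ (x : f1.domain) (y : f2.domain), (x : R) = y → f1 x = f2 y := by
    intro x y hxy
    refine (hz x ?_).trans rfl
    rw [hxy]; exact y.2
  have hs := LinearPMap.sup_apply H
  obtain ⟨φ, hφ⟩ : ∃ φ : ↥(J ⊔ K) →ₗ[R] Y, ∀ (a : J) (b : K) (z : ↥(J ⊔ K)),
      (a : R) + b = z → φ z = g a :=
    ⟨(f1.sup f2 H).toFun, fun a b z h => (hs a b z h).trans (add_zero _)⟩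
  obtain ⟨y, hy, hyy⟩ := h (J ⊔ K) φ (by
    rintro ⟨z, hz⟩
    obtain ⟨a, ha, b, hb, hab⟩ := Submodule.mem_sup.1 hz
    rw [hφ ⟨a, ha⟩ ⟨b, hb⟩ ⟨z, hz⟩ hab]
    exact hg _)
  refine ⟨y, hy, fun j => ?_, fun k hk => ?_⟩
  · rw [← hφ j 0 ⟨j, (le_sup_left : J ≤ J ⊔ K) j.2⟩ (by simp)]
    exact hyy ⟨j, (le_sup_left : J ≤ J ⊔ K) j.2⟩
  · have h1 := hyy ⟨k, (le_sup_right : K ≤ J ⊔ K) hk⟩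
    rw [hφ 0 ⟨k, hk⟩ _ (by simp), map_zero] at h1
    exact h1.symm

lemma artinRees [IsNoetherianRing R] (a J : Ideal R) : ∃ n : ℕ, a ^ n ⊓ J ≤ a * J := by
  obtain ⟨k, hk⟩ := Ideal.exists_pow_inf_eq_pow_smul (M := R) a J
  refine ⟨k + 1, ?_⟩
  have h := hk (k + 1) (by omega)
  simp only [smul_eq_mul, Ideal.mul_top] at h
  rw [h, show k + 1 - k = 1 by omega, pow_one]
  exact Ideal.mul_mono_right inf_le_right

lemma InjS.inf_gamA [IsNoetherianRing R] {N : Submodule R Y} (h : InjS N) (A : Submonoid (Ideal R)) :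
    InjS (N ⊓ gamA A Y) := by
  intro J g hg
  obtain ⟨a, ha, hag⟩ := gamA_fg_map g (fun t => (hg t).2)
  obtain ⟨n, hn⟩ := artinRees a J
  have hz : ∀ t ∈ a * J, ∀ ht : t ∈ J, g ⟨t, ht⟩ = 0 := by
    have hle : a * J ≤ Submodule.map J.subtype (LinearMap.ker g) := by
      refine Ideal.mul_le.2 fun r hr j hj => ?_
      refine ⟨r • ⟨j, hj⟩, ?_, rfl⟩
      show g (r • ⟨j, hj⟩) = 0
      rw [map_smul, hag r hr]
    intro t ht ht'
    obtain ⟨⟨t', h1⟩, h2, rfl⟩ := hle ht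
    exact h2
  obtain ⟨y, hy, h1, h2⟩ := h.glue J (a ^ n) g (fun j => (hg j).1)
    (fun j hj => hz j (hn ⟨hj, j.2⟩) j.2)
  exact ⟨y, ⟨hy, a ^ n, A.pow_mem ha n, h2⟩, h1⟩

/-- torsion of a product of two ideals -/
lemma tors_split [IsNoetherianRing R] (hY : Module.Injective R Y) (a b : Ideal R) (x : Y)
    (hx : ∀ r ∈ a * b, r • x = 0) :
    ∃ y z : Y, x = y + z ∧ (∃ n : ℕ, ∀ r ∈ a ^ n, r • y = 0) ∧ ∀ r ∈ b, r • z = 0 := by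
  obtain ⟨n, hn⟩ := artinRees a b
  obtain ⟨z, -, h1, h2⟩ := (InjS.top hY).glue (a ^ n) b
    ((LinearMap.toSpanSingleton R Y x) ∘ₗ (a ^ n).subtype) (fun _ => trivial)
    (fun j hj => hx _ (hn ⟨j.2, hj⟩))
  refine ⟨x - z, z, by abel, ⟨n, fun r hr => ?_⟩, h2⟩
  rw [smul_sub, ← h1 ⟨r, hr⟩]
  simp

/-- exactness with values in a submodule -/
def LExS (δ : Y →ₗ[R] Y) (N : Submodule R Y) (L : Type u) [AddCommGroup L] [Module R L] : Prop :=
  ∀ f : L →ₗ[R] Y, (∀ t, f t ∈ N) → δ ∘ₗ f = 0 → ∃ h : L →ₗ[R] Y, (∀ t, h t ∈ N) ∧ δ ∘ₗ h = f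

lemma mem_gam_x (x : R) (y : Y) : y ∈ gamA (Submonoid.powers (Ideal.span {x})) Y ↔
    ∃ n : ℕ, x ^ n • y = 0 := by
  constructor
  · rintro ⟨_, ⟨n, rfl⟩, h⟩
    refine ⟨n, h _ ?_⟩
    exact Ideal.pow_mem_pow (Ideal.mem_span_singleton_self x) n
  · rintro ⟨n, h⟩
    refine ⟨_, ⟨n, rfl⟩, fun r hr => ?_⟩
    simp only [Ideal.span_singleton_pow] at hr
    obtain ⟨c, rfl⟩ := Ideal.mem_span_singleton'.1 hr
    rw [mul_smul, h, smul_zero]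

lemma LExS.step [IsNoetherianRing R] [Module.Finite R L] {δ : Y →ₗ[R] Y} (hδ : δ ∘ₗ δ = 0)
    {N : Submodule R Y}
    (hN : InjS N) (hst : ∀ y ∈ N, δ y ∈ N) (h : LExS δ N L) (x : R) :
    LExS δ (N ⊓ gamA (Submonoid.powers (Ideal.span {x})) Y) L := by
  intro f hf hδf
  obtain ⟨_, ⟨n, rfl⟩, ha⟩ := gamA_fg_map f (fun t => (hf t).2)
  have hxn : ∀ t, x ^ n • f t = 0 :=
    fun t => ha _ (Ideal.pow_mem_pow (Ideal.mem_span_singleton_self x) n) t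
  obtain ⟨g, hgN, hg⟩ := h f (fun t => (hf t).1) hδf
  have hg' : ∀ t, δ (g t) = f t := fun t => LinearMap.congr_fun hg t
  obtain ⟨w, hwN, hw⟩ := h (x ^ n • g) (fun t => N.smul_mem _ (hgN t)) (by
    ext t
    simp [hg', hxn])
  have hw' : ∀ t, δ (w t) = x ^ n • g t := fun t => LinearMap.congr_fun hw t
  -- stabilization
  obtain ⟨k, hk⟩ := monotone_stabilizes_iff_noetherian.2 (inferInstance : IsNoetherian R L)
    ⟨fun k => LinearMap.ker (LinearMap.lsmul R L (x ^ k)), by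
      intro k l hkl t ht
      simp only [LinearMap.mem_ker, LinearMap.lsmul_apply] at ht ⊢
      obtain ⟨c, rfl⟩ := Nat.exists_eq_add_of_le hkl
      rw [pow_add, mul_comm, mul_smul, ht, smul_zero]⟩
  have hk' : ∀ t : L, x ^ (k + n) • t = 0 → x ^ k • t = 0 := by
    intro t ht
    have := hk (k + n) (by omega)
    have h2 : t ∈ LinearMap.ker (LinearMap.lsmul R L (x ^ (k + n))) := ht
    have h3 : t ∈ LinearMap.ker (LinearMap.lsmul R L (x ^ k)) := by
      have := (SetLike.ext_iff.1 this t).2 h2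
      exact this
    exact h3
  let ψ : L →ₗ[R] L := LinearMap.lsmul R L (x ^ (k + n))
  let w' : L →ₗ[R] N := LinearMap.codRestrict N w hwN
  obtain ⟨v0, hv0⟩ := factor_surj ψ.rangeRestrict ψ.surjective_rangeRestrict (x ^ k • w') (by
    intro t ht
    have : x ^ (k + n) • t = 0 := congrArg Subtype.val ht
    have h3 := hk' t this
    rw [LinearMap.smul_apply, ← map_smul, h3, map_zero])
  have := hN.injective
  obtain ⟨v, hv⟩ := Module.Injective.extension_property R N _ _ ψ.range.subtype
    (Submodule.subtype_injective _) v0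
  have hv' : ∀ t, (v (x ^ (k + n) • t) : Y) = x ^ k • w t := by
    intro t
    have h1 := LinearMap.congr_fun hv (ψ.rangeRestrict t)
    have h2 := LinearMap.congr_fun hv0 t
    exact congrArg Subtype.val (h1.trans h2)
  refine ⟨g - δ ∘ₗ N.subtype ∘ₗ v, fun t => ⟨N.sub_mem (hgN t) (hst _ (v t).2), ?_⟩, ?_⟩
  · rw [SetLike.mem_coe, mem_gam_x]
    refine ⟨k + n, ?_⟩
    have h5 : x ^ (k + n) • δ (v t : Y) = δ (v (x ^ (k + n) • t) : Y) := by
      rw [map_smul, Submodule.coe_smul, map_smul]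
    show x ^ (k + n) • (g t - δ (v t : Y)) = 0
    rw [smul_sub, h5, hv', map_smul, hw', pow_add, mul_smul, sub_self]
  · ext t
    have h3 := LinearMap.congr_fun hδ (v t : Y)
    simp only [LinearMap.comp_apply, LinearMap.zero_apply] at h3
    simp [hg', h3]

lemma LExS.to_gamA [IsNoetherianRing R] [Module.Finite R L] {δ : Y →ₗ[R] Y} (hδ : δ ∘ₗ δ = 0)
    (hY : Module.Injective R Y) (h : Cls δ L) (A : Submonoid (Ideal R)) :
    LExS δ (gamA A Y) L := by
  classical
  have key : ∀ s : Finset R, ∃ N : Submodule R Y, InjS N ∧ (∀ y ∈ N, δ y ∈ N) ∧ LExS δ N L ∧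
      ∀ y, y ∈ N ↔ ∀ x ∈ s, ∃ n : ℕ, x ^ n • y = 0 := by
    intro s
    induction s using Finset.induction_on with
    | empty =>
      refine ⟨⊤, InjS.top hY, fun _ _ => trivial, ?_, by simp⟩
      intro f _ hf
      obtain ⟨k, hk⟩ := h f hf
      exact ⟨k, fun _ => trivial, hk⟩
    | insert x s _ ih =>
      obtain ⟨N, h1, h2, h3, h4⟩ := ih
      refine ⟨N ⊓ gamA (Submonoid.powers (Ideal.span {x})) Y, h1.inf_gamA _, ?_,
        h3.step hδ h1 h2 x, ?_⟩
      · rintro y ⟨hy1, hy2⟩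
        exact ⟨h2 y hy1, gamA_map δ hy2⟩
      · intro y
        rw [Submodule.mem_inf, h4, mem_gam_x, Finset.forall_mem_insert, and_comm]
  intro f hf hδf
  obtain ⟨a, ha, haf⟩ := gamA_fg_map f hf
  obtain ⟨s, hs⟩ := (isNoetherianRing_iff_ideal_fg R).1 inferInstance a
  obtain ⟨N, -, -, h3, h4⟩ := key s
  obtain ⟨g, hgN, hg⟩ := h3 f (fun t => (h4 _).2 (fun x hx => ⟨1, by
    rw [pow_one]
    exact haf x (hs ▸ Ideal.subset_span hx) t⟩)) hδf
  refine ⟨g, fun t => ?_, hg⟩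
  have h5 := (h4 _).1 (hgN t)
  obtain ⟨m, hm⟩ := Ideal.exists_pow_le_of_le_radical_of_fg (I := a)
    (J := Ideal.torsionOf R Y (g t)) (by
      rw [← hs]
      refine Ideal.span_le.2 fun x hx => ?_
      obtain ⟨n, hn⟩ := h5 x hx
      exact ⟨n, hn⟩) ⟨s, hs⟩
  exact ⟨a ^ m, A.pow_mem ha m, fun r hr => hm hr⟩
end Part6

section Part7
variable {R : Type u} [CommRing R]

lemma mem_torsionGamma {a : Ideal R} {M : Type u} [AddCommGroup M] [Module R M] {x : M} :
    x ∈ torsionGamma a M ↔ ∃ n : ℕ, ∀ r ∈ a ^ n, r • x = 0 := by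
  unfold torsionGamma
  rw [Submodule.mem_iSup_of_directed]
  · simp [Submodule.mem_torsionBySet_iff]
  · refine Monotone.directed_le ?_
    intro m n h
    exact Submodule.torsionBySet_le_torsionBySet_of_subset (Ideal.pow_le_pow_right h)

/-- the sum of the torsion submodules at primes of height `k` -/
def sumS (R : Type u) [CommRing R] (k : ℕ) (M : Type u) [AddCommGroup M] [Module R M] :
    Submodule R M :=
  ⨆ (p : PrimeSpectrum R) (_ : Order.height p = (k : ℕ∞)), torsionGamma p.asIdeal M

/-- products of primes of height `k` -/
def clA (R : Type u) [CommRing R] (k : ℕ) : Submonoid (Ideal R) :=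
  Submonoid.closure {a | ∃ p : PrimeSpectrum R, Order.height p = (k : ℕ∞) ∧ p.asIdeal = a}

variable {M : Type u} [AddCommGroup M] [Module R M]
variable {L : Type u} [AddCommGroup L] [Module R L]

lemma mem_clA {k : ℕ} (p : PrimeSpectrum R) (hp : Order.height p = (k : ℕ∞)) :
    p.asIdeal ∈ clA R k := Submonoid.subset_closure ⟨p, hp, rfl⟩

lemma le_sumS {k : ℕ} (p : PrimeSpectrum R) (hp : Order.height p = (k : ℕ∞)) :
    torsionGamma p.asIdeal M ≤ sumS R k M :=
  le_iSup₂_of_le p hp le_rfl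

lemma sumS_le_gamA (k : ℕ) : sumS R k M ≤ gamA (clA R k) M := by
  refine iSup₂_le fun p hp x hx => ?_
  obtain ⟨n, hn⟩ := mem_torsionGamma.1 hx
  exact ⟨p.asIdeal ^ n, Submonoid.pow_mem _ (mem_clA p hp) n, hn⟩

lemma sumS_map {k : ℕ} (f : L →ₗ[R] M) : Submodule.map f (sumS R k L) ≤ sumS R k M := by
  unfold sumS
  simp only [Submodule.map_iSup]
  refine iSup₂_mono fun p hp => ?_
  rintro _ ⟨x, hx, rfl⟩
  obtain ⟨n, hn⟩ := mem_torsionGamma.1 hx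
  exact mem_torsionGamma.2 ⟨n, fun r hr => by rw [← map_smul, hn r hr, map_zero]⟩

lemma gamA_le_sumS_of_inj [IsNoetherianRing R] (hM : Module.Injective R M) (k : ℕ) :
    gamA (clA R k) M ≤ sumS R k M := by
  rintro x ⟨a, ha, hx⟩
  have key : ∀ n : ℕ, ∀ x : M, (∀ r ∈ a ^ n, r • x = 0) → x ∈ sumS R k M := by
    clear hx x
    induction ha using Submonoid.closure_induction with
    | mem a ha =>
      obtain ⟨p, hp, rfl⟩ := ha
      intro n x hx
      exact le_sumS p hp (mem_torsionGamma.2 ⟨n, hx⟩)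
    | one =>
      intro n x hx
      have := hx 1 (by rw [one_pow, Ideal.one_eq_top]; trivial)
      rw [one_smul] at this
      rw [this]; exact Submodule.zero_mem _
    | mul a b _ _ iha ihb =>
      intro n x hx
      rw [mul_pow] at hx
      obtain ⟨y, z, rfl, ⟨m, hy⟩, hz⟩ := tors_split hM _ _ x hx
      rw [← pow_mul] at hy
      exact Submodule.add_mem _ (iha _ _ hy) (ihb _ _ hz)
  exact key 1 x (by rwa [pow_one])

lemma gamA_mono {A B : Submonoid (Ideal R)} (h : ∀ a ∈ A, ∃ b ∈ B, b ≤ a) :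
    gamA A M ≤ gamA B M := by
  rintro x ⟨a, ha, hx⟩
  obtain ⟨b, hb, hba⟩ := h a ha
  exact ⟨b, hb, fun r hr => hx r (hba hr)⟩

lemma clA_succ (k : ℕ) : ∀ a ∈ clA R (k + 1), ∃ b ∈ clA R k, b ≤ a := by
  intro a ha
  induction ha using Submonoid.closure_induction with
  | mem a ha =>
    obtain ⟨p, hp, rfl⟩ := ha
    obtain ⟨q, hq, hqk⟩ : ∃ q < p, Order.height q = (k : ℕ∞) := by
      rw [Nat.cast_add, Nat.cast_one] at hp
      have := (Order.height_eq_coe_add_one_iff (x := p) (n := k)).1 hp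
      exact this.2.1
    exact ⟨q.asIdeal, mem_clA q hqk, hq.le⟩
  | one => exact ⟨1, Submonoid.one_mem _, le_rfl⟩
  | mul a b _ _ iha ihb =>
    obtain ⟨a', ha', h1⟩ := iha
    obtain ⟨b', hb', h2⟩ := ihb
    exact ⟨a' * b', Submonoid.mul_mem _ ha' hb', Ideal.mul_mono h1 h2⟩

lemma sumS_top [IsNoetherianRing R] : gamA (clA R 0) M = ⊤ := by
  have hfin : (minimalPrimes R).Finite := minimalPrimes.finite_of_isNoetherianRing R
  have h1 : (∏ p ∈ hfin.toFinset, p) ∈ clA R 0 := by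
    refine Submonoid.prod_mem _ fun p hp => ?_
    rw [Set.Finite.mem_toFinset] at hp
    have hpp : p.IsPrime := hp.1.1
    refine mem_clA ⟨p, hpp⟩ ?_
    rw [Nat.cast_zero, Order.height_eq_zero]
    intro q hq
    exact hp.2 ⟨q.2, bot_le⟩ hq
  have h2 : (∏ p ∈ hfin.toFinset, p) ≤ nilradical R := by
    refine Ideal.prod_le_inf.trans ?_
    rw [nilradical, ← Ideal.sInf_minimalPrimes]
    refine le_sInf fun p hp => ?_
    exact Finset.inf_le (f := fun p => p) (hfin.mem_toFinset.2 hp)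
  obtain ⟨n, hn⟩ := IsNoetherianRing.isNilpotent_nilradical R
  refine eq_top_iff.2 fun x _ => ⟨_, Submonoid.pow_mem _ h1 n, fun r hr => ?_⟩
  have := Ideal.pow_right_mono h2 n hr
  rw [hn] at this
  rw [(Submodule.mem_bot R).1 this, zero_smul]

lemma sumS_bot (d : ℕ) (hdim : ringKrullDim R = (d : ℕ)) : sumS R (d + 1) M = ⊥ := by
  refine eq_bot_iff.2 (iSup₂_le fun p hp => ?_)
  exfalso
  have := Order.height_le_krullDim p
  rw [hp] at this
  have h3 : ringKrullDim R = Order.krullDim (PrimeSpectrum R) := rfl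
  rw [← h3, hdim] at this
  have h4 : ((d + 1 : ℕ) : ℕ∞) ≤ (d : ℕ∞) := by exact_mod_cast this
  have h5 : d + 1 ≤ d := by exact_mod_cast h4
  omega

section data
variable {E : ℤ → Type u} [∀ i, AddCommGroup (E i)] [∀ i, Module R (E i)]

lemma fam_exact [IsNoetherianRing R] (hinj : ∀ i, Module.Injective R (E i))
    (d : ∀ i : ℤ, E (i + 1) →ₗ[R] E i) (hd : ∀ i x, d i (d (i + 1) x) = 0)
    [Module.Finite R L] (hL : Cls (tot d) L) (A : Submonoid (Ideal R)) (i : ℤ)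
    (f : L →ₗ[R] E (i + 1)) (hfA : ∀ t, f t ∈ gamA A (E (i + 1))) (hf : (d i) ∘ₗ f = 0) :
    ∃ h : L →ₗ[R] E (i + 1 + 1), (∀ t, h t ∈ gamA A (E (i + 1 + 1))) ∧ (d (i + 1)) ∘ₗ h = f := by
  have hY : Module.Injective R (∀ i, E i) := inferInstance
  obtain ⟨h, hhA, hh⟩ := LExS.to_gamA (tot_tot d hd) hY hL A
    (LinearMap.single R E (i + 1) ∘ₗ f) (fun t => gamA_map (LinearMap.single R E (i + 1)) (hfA t)) (by
      apply LinearMap.ext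
      intro x
      funext j
      show d j ((Pi.single (i + 1) (f x) : ∀ i, E i) (j + 1)) = 0
      by_cases hj : j = i
      · subst hj
        rw [Pi.single_eq_same]
        exact LinearMap.congr_fun hf x
      · rw [Pi.single_eq_of_ne (by omega), map_zero])
  refine ⟨LinearMap.proj (i + 1 + 1) ∘ₗ h, fun t => gamA_map (LinearMap.proj (i + 1 + 1)) (hhA t),
    ?_⟩
  apply LinearMap.ext
  intro x
  have := congrFun (LinearMap.congr_fun hh x) (i + 1)
  refine this.trans ?_
  show (Pi.single (i + 1) (f x) : ∀ i, E i) (i + 1) = f x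
  rw [Pi.single_eq_same]

lemma cls_R (d : ∀ i : ℤ, E (i + 1) →ₗ[R] E i)
    (hex : ∀ i : ℤ, LinearMap.range (d (i + 1)) = LinearMap.ker (d i)) : Cls (tot d) R := by
  rw [cls_tot_iff]
  intro i f hf
  have : f 1 ∈ LinearMap.range (d (i + 1)) := by
    rw [hex]; exact LinearMap.congr_fun hf 1
  obtain ⟨y, hy⟩ := this
  refine ⟨LinearMap.toSpanSingleton R _ y, ?_⟩
  ext
  simp [hy]

lemma fam_exact_elt [IsNoetherianRing R] (hinj : ∀ i, Module.Injective R (E i))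
    (d : ∀ i : ℤ, E (i + 1) →ₗ[R] E i)
    (hex : ∀ i : ℤ, LinearMap.range (d (i + 1)) = LinearMap.ker (d i))
    (A : Submonoid (Ideal R)) (i : ℤ) (x : E (i + 1)) (hx : x ∈ gamA A (E (i + 1)))
    (hdx : d i x = 0) : ∃ z ∈ gamA A (E (i + 1 + 1)), d (i + 1) z = x := by
  have hd : ∀ i x, d i (d (i + 1) x) = 0 := fun i x =>
    (SetLike.ext_iff.1 (hex i) (d (i + 1) x)).1 ⟨x, rfl⟩
  obtain ⟨h, h1, h2⟩ := fam_exact hinj d hd (cls_R d hex) A i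
    (LinearMap.toSpanSingleton R _ x) (fun t => Submodule.smul_mem _ _ hx) (by
      ext
      simp [hdx])
  refine ⟨h 1, h1 1, ?_⟩
  have := LinearMap.congr_fun h2 1
  simpa using this
end data

lemma gi_gamA_le [IsNoetherianRing R] (H : GorensteinInjData R M) (k : ℕ) :
    gamA (clA R k) M ≤ sumS R k M := by
  intro x hx
  obtain @⟨E, _, _, d, hinj, hex, hom, e⟩ := H
  have hx1 : ((e x : LinearMap.ker (d (-1))) : E (-1 + 1)) ∈ gamA (clA R k) (E (-1 + 1)) :=
    gamA_map ((LinearMap.ker (d (-1))).subtype ∘ₗ e.toLinearMap) hx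
  obtain ⟨z, hz, hzx⟩ := fam_exact_elt hinj d hex (clA R k) (-1) _ hx1 (e x).2
  have hz2 := gamA_le_sumS_of_inj (hinj _) k hz
  have hd : ∀ y, d (-1 + 1) y ∈ LinearMap.ker (d (-1)) := fun y =>
    (SetLike.ext_iff.1 (hex (-1)) _).1 ⟨y, rfl⟩
  let φ : E (-1 + 1 + 1) →ₗ[R] M :=
    e.symm.toLinearMap ∘ₗ LinearMap.codRestrict _ (d (-1 + 1)) hd
  have h3 : φ z = x := by
    have : LinearMap.codRestrict _ (d (-1 + 1)) hd z = e x := Subtype.ext hzx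
    show e.symm (LinearMap.codRestrict _ (d (-1 + 1)) hd z) = x
    rw [this, e.symm_apply_apply]
  rw [← h3]
  exact sumS_map φ ⟨z, hz2, rfl⟩

/-- restriction of a linear map to torsion submodules -/
def gamRes (A : Submonoid (Ideal R)) (f : L →ₗ[R] M) : gamA A L →ₗ[R] gamA A M :=
  f.restrict (fun _ hx => gamA_map f hx)

lemma gi_gamA [IsNoetherianRing R] {D : Type u} [AddCommGroup D] [Module R D]
    (hD : IsDualizingModule R D) (H : GorensteinInjData R M) (A : Submonoid (Ideal R)) :
    IsGorensteinInjective R (gamA A M) := by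
  obtain @⟨E, _, _, d, hinj, hex, hom, e⟩ := H
  have hfin := hD.1
  have hd : ∀ i x, d i (d (i + 1) x) = 0 := fun i x =>
    (SetLike.ext_iff.1 (hex i) (d (i + 1) x)).1 ⟨x, rfl⟩
  have hY : Module.Injective R (∀ i, E i) := inferInstance
  have hcE : ∀ (E' : Type u) [AddCommGroup E'] [Module R E'], Module.Injective R E' →
      Cls (tot d) E' := by
    intro E' _ _ hE'
    rw [cls_tot_iff]
    exact fun i f hf => (hom E' hE' i f).1 hf
  have hcD : Cls (tot d) D := by
    obtain ⟨n, hn⟩ := hD.resN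
    exact cls_of_resN hY (tot_tot d hd) hcE n _ hn
  let d' : ∀ i : ℤ, gamA A (E (i + 1)) →ₗ[R] gamA A (E i) := fun i => gamRes A (d i)
  have hinj' : ∀ i, Module.Injective R (gamA A (E i)) := by
    intro i
    have h := (InjS.top (hinj i)).inf_gamA A
    rw [top_inf_eq] at h
    exact h.injective
  have hd' : ∀ i x, d' i (d' (i + 1) x) = 0 := fun i x => Subtype.ext (hd i x)
  have hY' : Module.Injective R (∀ i, gamA A (E i)) := inferInstance
  have hcD' : Cls (tot (R := R) (E := fun i => gamA A (E i)) d') D := by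
    rw [cls_tot_iff]
    intro i f hf
    obtain ⟨h, h1, h2⟩ := fam_exact hinj d hd hcD A i ((gamA A _).subtype ∘ₗ f)
      (fun t => (f t).2) (by
        ext t
        exact congrArg Subtype.val (LinearMap.congr_fun hf t))
    refine ⟨LinearMap.codRestrict _ h h1, ?_⟩
    ext t
    exact LinearMap.congr_fun h2 t
  have hcE' : ∀ (E' : Type u) [AddCommGroup E'] [Module R E'], Module.Injective R E' →
      Cls (tot (R := R) (E := fun i => gamA A (E i)) d') E' := fun E' _ _ hE' => core hY' (tot_tot (R := R) (E := fun i => gamA A (E i)) d' hd') hD hcD' E' hE'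
  let f1 : gamA A M →ₗ[R] LinearMap.ker (d' (-1)) :=
    LinearMap.codRestrict _ (gamRes A ((LinearMap.ker (d (-1))).subtype ∘ₗ e.toLinearMap))
      (fun x => Subtype.ext (e x).2)
  have hf1 : Function.Bijective f1 := by
    constructor
    · intro x y hxy
      have h0 : (f1 x : gamA A (E (-1 + 1))) = f1 y := congrArg Subtype.val hxy
      have h1 : ((f1 x : gamA A (E (-1 + 1))) : E (-1 + 1)) = (f1 y : gamA A (E (-1 + 1))) :=
        congrArg Subtype.val h0
      exact Subtype.ext (e.injective (Subtype.ext h1))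
    · rintro ⟨⟨y, hy⟩, hyk⟩
      have hyk' : d (-1) y = 0 := congrArg Subtype.val hyk
      obtain ⟨a, ha, hay⟩ := hy
      refine ⟨⟨e.symm ⟨y, hyk'⟩, a, ha, fun r hr => ?_⟩, ?_⟩
      · rw [← map_smul]
        have : r • (⟨y, hyk'⟩ : LinearMap.ker (d (-1))) = 0 := Subtype.ext (hay r hr)
        rw [this, map_zero]
      · apply Subtype.ext
        apply Subtype.ext
        show ((e (e.symm ⟨y, hyk'⟩) : LinearMap.ker (d (-1))) : E (-1 + 1)) = y
        rw [e.apply_symm_apply]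
  refine ⟨⟨fun i => gamA A (E i), d', hinj', ?_, ?_, LinearEquiv.ofBijective f1 hf1⟩⟩
  · intro i
    ext x
    constructor
    · rintro ⟨y, rfl⟩
      exact hd' i y
    · intro hx
      obtain ⟨z, hz, hzx⟩ := fam_exact_elt hinj d hex A i x x.2 (congrArg Subtype.val hx)
      exact ⟨⟨z, hz⟩, Subtype.ext hzx⟩
  · intro E' _ _ hE' i g
    constructor
    · exact (cls_tot_iff (R := R) (E := fun i => gamA A (E i)) d' E').1 (hcE' E' hE') i g
    · rintro ⟨f, rfl⟩
      ext t
      exact congrArg Subtype.val (hd' i (f t))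

end Part7

/-- the filtration `G_k = Σ_{ht p = k} Γ_p(G)` of a Gorenstein injective
module via the section functors. -/
theorem gorensteinInjective_filtration_via_sections
    {R : Type u} [CommRing R] [IsNoetherianRing R]
    (D : Type u) [AddCommGroup D] [Module R D] (hD : IsDualizingModule R D)
    (d : ℕ) (hdim : ringKrullDim R = (d : ℕ))
    (G : Type u) [AddCommGroup G] [Module R G] (hG : IsGorensteinInjective R G)
    (Gs : ℕ → Submodule R G)
    (hGs : ∀ k : ℕ, Gs k =
      ⨆ (p : PrimeSpectrum R) (_ : Order.height p = (k : ℕ∞)),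
        torsionGamma p.asIdeal G) :
    Gs (d + 1) = ⊥ ∧
    Gs 0 = ⊤ ∧
    (∀ k, k ≤ d → Gs (k + 1) ≤ Gs k) ∧
    (∀ k : ℕ, IsGorensteinInjective R (Gs k)) ∧
    (∀ k, k ≤ d →
      Submodule.map (Gs (k + 1)).mkQ (Gs k) =
        ⨆ (p : PrimeSpectrum R) (_ : Order.height p = (k : ℕ∞)),
          torsionGamma p.asIdeal (G ⧸ Gs (k + 1))) := by
  obtain ⟨H⟩ := hG
  have h1 : ∀ k, Gs k = sumS R k G := hGs
  have h2 : ∀ k, Gs k = gamA (clA R k) G := fun k =>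
    (h1 k).trans (le_antisymm (sumS_le_gamA k) (gi_gamA_le H k))
  refine ⟨?_, ?_, ?_, ?_, ?_⟩
  · rw [h1]; exact sumS_bot d hdim
  · rw [h2]; exact sumS_top
  · intro k _
    rw [h2, h2]; exact gamA_mono (clA_succ k)
  · intro k
    rw [h2]; exact gi_gamA hD H _
  · intro k _
    apply le_antisymm
    · rw [h1 k]
      exact sumS_map (k := k) (Gs (k + 1)).mkQ
    · refine iSup₂_le fun p hp y hy => ?_
      obtain ⟨x, rfl⟩ := (Gs (k + 1)).mkQ_surjective y
      obtain ⟨n, hn⟩ := mem_torsionGamma.1 hy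
      refine ⟨x, ?_, rfl⟩
      have hn' : ∀ r ∈ p.asIdeal ^ n, r • x ∈ gamA (clA R (k + 1)) G := by
        intro r hr
        have := hn r hr
        rw [← map_smul] at this
        rw [← h2]
        exact (Submodule.Quotient.mk_eq_zero _).1 this
      obtain ⟨b, hb, hbx⟩ := gamA_fg_map
        ((LinearMap.toSpanSingleton R G x) ∘ₗ (p.asIdeal ^ n).subtype)
        (fun t => hn' t t.2)
      obtain ⟨c, hc, hcb⟩ := clA_succ k b hb
      show x ∈ Gs k
      rw [h2]
      refine ⟨c * p.asIdeal ^ n, Submonoid.mul_mem _ hc (Submonoid.pow_mem _ (mem_clA p hp) n), ?_⟩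
      intro r hr
      have hle : c * p.asIdeal ^ n ≤ Ideal.torsionOf R G x := by
        refine Ideal.mul_le.2 fun s hs t ht => ?_
        rw [Ideal.mem_torsionOf_iff, mul_smul]
        exact hbx s (hcb hs) ⟨t, ht⟩
      exact (Ideal.mem_torsionOf_iff x r).1 (hle hr)
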